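/- arXiv:2501.05889 — 3 statements merged into one kernel-verified Lean document; each statement's English description precedes it below -/
import Mathlib

section
/- Let d ≥ 2 be an integer, let κ ∈ ℂ \ {0}, and let f ∈ L¹(ℝ^d) be a radial function (i.e. f(x) = f₀(|x|) a.e. for some f₀) with compact support. Then for every ξ ∈ ℝ^d the series ∑_{ℓ=0}^∞ σ_ℓ[f,κ] · Z_{ℓ,d}(1 − |ξ|²/(2κ)) converges absolutely, and the Fourier transform of f satisfies ∫_{ℝ^d} f(x) e^{−i ξ·x} dx = (2π)^d ∑_{ℓ=0}^∞ σ_ℓ[f,κ] · Z_{ℓ,d}(1 − |ξ|²/(2κ)). -/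
open MeasureTheory

noncomputable section

/-- Area of the unit sphere `S^{d-1}`: `2 π^{d/2} / Γ(d/2)`. -/
def sphereArea (d : ℕ) : ℝ := 2 * Real.pi ^ ((d : ℝ) / 2) / Real.Gamma ((d : ℝ) / 2)

/-- The entire function φ_ℓ (with ν_d = (d-2)/2). -/
def phiF (d ℓ : ℕ) (z : ℂ) : ℂ :=
  z ^ ℓ / (2 : ℂ) ^ ((ℓ : ℂ) + ((d : ℂ) - 2) / 2) *
    ∑' n : ℕ, ((-1 : ℂ) ^ n / ((n.factorial : ℂ) *
      Complex.Gamma ((ℓ : ℂ) + ((d : ℂ) - 2) / 2 + (n : ℂ) + 1))) * (z / 2) ^ (2 * n)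

/-- Dimension `N_{ℓ,d}` of the space of spherical harmonics of degree ℓ. -/
def Nld (d ℓ : ℕ) : ℕ :=
  (ℓ + d - 1).choose ℓ - if 2 ≤ ℓ then (ℓ + d - 3).choose (ℓ - 2) else 0

/-- Rodrigues-type right-hand side defining the generalized Legendre polynomial. -/
def legendreRHS (d ℓ : ℕ) (t : ℝ) : ℝ :=
  (-1 : ℝ) ^ ℓ * (Real.Gamma (((d : ℝ) - 1) / 2) /
      (2 ^ ℓ * Real.Gamma ((ℓ : ℝ) + ((d : ℝ) - 1) / 2))) *
    (1 - t ^ 2) ^ (-(((d : ℝ) - 3) / 2)) *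
    iteratedDeriv ℓ (fun s : ℝ => (1 - s ^ 2) ^ ((ℓ : ℝ) + ((d : ℝ) - 3) / 2)) t

/-- `P` is the generalized Legendre polynomial `P_{ℓ,d}`. -/
def IsLegendre (d ℓ : ℕ) (P : Polynomial ℂ) : Prop :=
  P.natDegree = ℓ ∧ ∀ t : ℝ, t ∈ Set.Ioo (-1 : ℝ) 1 →
    P.eval (t : ℂ) = (legendreRHS d ℓ t : ℂ)

/-- The κ-moment `σ_ℓ[f,κ]` of an integrable function on `ℝ^d`. -/
def kappaMoment (d ℓ : ℕ) (κ : ℂ) (f : EuclideanSpace ℝ (Fin d) → ℂ) : ℂ :=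
  (1 / (sphereArea d : ℂ)) *
    ∫ x : EuclideanSpace ℝ (Fin d), f x * (phiF d ℓ (κ ^ (1/2 : ℂ) * (‖x‖ : ℂ))) ^ 2

/-- `Z_{ℓ,d}` evaluated via the Legendre polynomial `P`. -/
def zonal (d ℓ : ℕ) (P : Polynomial ℂ) (s : ℂ) : ℂ :=
  ((Nld d ℓ : ℂ) / (sphereArea d : ℂ)) * P.eval s

end

open scoped RealInnerProductSpace


namespace FRR

/-- The building block `(1 - s^2)^a`. -/
noncomputable def uu (a : ℝ) : ℝ → ℝ := fun s => (1 - s ^ 2) ^ a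

lemma one_sub_sq_pos {t : ℝ} (ht : t ∈ Set.Ioo (-1 : ℝ) 1) : 0 < 1 - t ^ 2 := by
  have h1 := ht.1
  have h2 := ht.2
  nlinarith

lemma uu_contDiffAt (a : ℝ) (n : ℕ) {t : ℝ} (ht : t ∈ Set.Ioo (-1 : ℝ) 1) :
    ContDiffAt ℝ n (uu a) t := by
  unfold uu
  refine ContDiffAt.rpow_const_of_ne ?_ (one_sub_sq_pos ht).ne'
  fun_prop

lemma uu_hasDerivAt (a : ℝ) {t : ℝ} (ht : t ∈ Set.Ioo (-1 : ℝ) 1) :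
    HasDerivAt (uu a) (-2 * a * (t * uu (a - 1) t)) t := by
  have h1 : HasDerivAt (fun s : ℝ => 1 - s ^ 2) (-(2 * t)) t := by
    simpa using (hasDerivAt_pow 2 t).const_sub 1
  have h := h1.rpow_const (p := a) (Or.inl (one_sub_sq_pos ht).ne')
  unfold uu
  convert! h using 1
  ring

lemma uu_mul (a : ℝ) {t : ℝ} (ht : t ∈ Set.Ioo (-1 : ℝ) 1) :
    uu (a + 1) t = (1 - t ^ 2) * uu a t := by
  unfold uu
  rw [Real.rpow_add_one (one_sub_sq_pos ht).ne']
  ring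

lemma iteratedDeriv_id_mul (n : ℕ) (g : ℝ → ℝ) (t : ℝ) (hg : ContDiffAt ℝ ((n + 1 : ℕ)) g t) :
    iteratedDeriv (n + 1) (fun s => s * g s) t
      = t * iteratedDeriv (n + 1) g t + (n + 1) * iteratedDeriv n g t := by
  rw [iteratedDeriv_fun_mul (by fun_prop) hg, Finset.sum_range_succ', Finset.sum_range_succ',
    Finset.sum_eq_zero]
  · simp [iteratedDeriv_fun_id]
    ring
  · intro i _
    simp [iteratedDeriv_fun_id]

/-- First relation. -/
lemma rel_one (n : ℕ) (b : ℝ) {t : ℝ} (ht : t ∈ Set.Ioo (-1 : ℝ) 1) :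
    iteratedDeriv (n + 2) (uu (b + 1)) t
      = -2 * (b + 1) * (t * iteratedDeriv (n + 1) (uu b) t
          + (n + 1) * iteratedDeriv n (uu b) t) := by
  rw [iteratedDeriv_succ']
  have h : Set.EqOn (deriv (uu (b + 1))) (fun s => -2 * (b + 1) * (s * uu b s))
      (Set.Ioo (-1 : ℝ) 1) := by
    intro s hs
    have := (uu_hasDerivAt (b + 1) hs).deriv
    simpa using this
  rw [h.iteratedDeriv_of_isOpen isOpen_Ioo (n + 1) ht, iteratedDeriv_const_mul,
    iteratedDeriv_id_mul]
  · exact uu_contDiffAt b _ ht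
  · exact contDiffAt_id.mul (uu_contDiffAt b _ ht)

/-- Second relation. -/
lemma rel_two (n : ℕ) (c : ℝ) {t : ℝ} (ht : t ∈ Set.Ioo (-1 : ℝ) 1) :
    iteratedDeriv (n + 2) (uu (c + 2)) t
      = 4 * (c + 2) * (c + 1) * iteratedDeriv n (uu c) t
        - 2 * (c + 2) * (2 * c + 3) * iteratedDeriv n (uu (c + 1)) t := by
  rw [iteratedDeriv_succ', iteratedDeriv_succ']
  have h1 : Set.EqOn (deriv (uu (c + 2))) (fun s => -2 * (c + 2) * (s * uu (c + 1) s))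
      (Set.Ioo (-1 : ℝ) 1) := by
    intro s hs
    have := (uu_hasDerivAt (c + 2) hs).deriv
    rw [this]
    norm_num [show c + 2 - 1 = c + 1 by ring]
  have h2 : Set.EqOn (deriv (deriv (uu (c + 2))))
      (fun s => 4 * (c + 2) * (c + 1) * uu c s + (- 2 * (c + 2) * (2 * c + 3)) * uu (c + 1) s)
      (Set.Ioo (-1 : ℝ) 1) := by
    intro s hs
    have he := h1.eventuallyEq_of_mem (isOpen_Ioo.mem_nhds hs)
    rw [he.deriv_eq]
    have h3 := ((hasDerivAt_id s).mul (uu_hasDerivAt (c + 1) hs)).const_mul (-2 * (c + 2))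
    have h4 := h3.deriv
    have h5 := uu_mul c hs
    simp only [add_sub_cancel_right, id] at h4
    refine Eq.trans ?_ (h4.trans ?_)
    · rfl
    · simp only [h5]; ring
  rw [h2.iteratedDeriv_of_isOpen isOpen_Ioo n ht, iteratedDeriv_fun_add, iteratedDeriv_const_mul,
    iteratedDeriv_const_mul]
  · ring
  · exact uu_contDiffAt _ _ ht
  · exact uu_contDiffAt _ _ ht
  · exact contDiffAt_const.mul (uu_contDiffAt _ _ ht)
  · exact contDiffAt_const.mul (uu_contDiffAt _ _ ht)

lemma legendreRHS_eq (d ℓ : ℕ) (t : ℝ) : legendreRHS d ℓ t =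
    (-1 : ℝ) ^ ℓ * (Real.Gamma (((d : ℝ) - 1) / 2) /
      (2 ^ ℓ * Real.Gamma ((ℓ : ℝ) + ((d : ℝ) - 1) / 2))) *
    (1 - t ^ 2) ^ (-(((d : ℝ) - 3) / 2)) *
    iteratedDeriv ℓ (uu ((ℓ : ℝ) + ((d : ℝ) - 3) / 2)) t := rfl

lemma legendre_zero (d : ℕ) (hd : 2 ≤ d) {t : ℝ} (ht : t ∈ Set.Ioo (-1 : ℝ) 1) :
    legendreRHS d 0 t = 1 := by
  have hd' : (2 : ℝ) ≤ d := by exact_mod_cast hd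
  have hp := one_sub_sq_pos ht
  have hG : Real.Gamma (((d : ℝ) - 1) / 2) ≠ 0 := (Real.Gamma_pos_of_pos (by linarith)).ne'
  rw [legendreRHS_eq]
  simp only [iteratedDeriv_zero, uu, pow_zero, one_mul, Nat.cast_zero, zero_add, div_self hG]
  rw [← Real.rpow_add hp]
  simp

lemma legendre_one (d : ℕ) (hd : 2 ≤ d) {t : ℝ} (ht : t ∈ Set.Ioo (-1 : ℝ) 1) :
    legendreRHS d 1 t = t := by
  have hd' : (2 : ℝ) ≤ d := by exact_mod_cast hd
  have hp := one_sub_sq_pos ht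
  have hg : ((d : ℝ) - 1) / 2 ≠ 0 := by linarith
  have hG : Real.Gamma (((d : ℝ) - 1) / 2) ≠ 0 := (Real.Gamma_pos_of_pos (by linarith)).ne'
  have h1 := legendre_zero d hd ht
  rw [legendreRHS_eq] at h1
  simp only [iteratedDeriv_zero, pow_zero, one_mul, Nat.cast_zero, zero_add, div_self hG] at h1
  rw [legendreRHS_eq, iteratedDeriv_one, (uu_hasDerivAt _ ht).deriv, Nat.cast_one,
    add_comm (1 : ℝ) (((d : ℝ) - 1) / 2), Real.Gamma_add_one hg,
    show (1 : ℝ) + ((d : ℝ) - 3) / 2 - 1 = ((d : ℝ) - 3) / 2 by ring]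
  have h2 : (1 - t ^ 2) ^ (-(((d : ℝ) - 3) / 2)) * uu (((d : ℝ) - 3) / 2) t = 1 := h1
  have h3 : Real.Gamma (((d : ℝ) - 1) / 2) /
    (2 ^ 1 * (((d : ℝ) - 1) / 2 * Real.Gamma (((d : ℝ) - 1) / 2))) * (1 + ((d : ℝ) - 3) / 2) * 2 = 1 := by
    have hne : (d : ℝ) - 1 ≠ 0 := by linarith
    field_simp
    ring
  calc _ = (Real.Gamma (((d : ℝ) - 1) / 2) /
    (2 ^ 1 * (((d : ℝ) - 1) / 2 * Real.Gamma (((d : ℝ) - 1) / 2))) * (1 + ((d : ℝ) - 3) / 2) * 2)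
      * ((1 - t ^ 2) ^ (-(((d : ℝ) - 3) / 2)) * uu (((d : ℝ) - 3) / 2) t) * t := by ring
    _ = t := by rw [h2, h3]; ring

lemma legendre_rec (d : ℕ) (hd : 2 ≤ d) (n : ℕ) {t : ℝ} (ht : t ∈ Set.Ioo (-1 : ℝ) 1) :
    (2 * n + d) * (t * legendreRHS d (n + 1) t)
      = (n + d - 1) * legendreRHS d (n + 2) t + (n + 1) * legendreRHS d n t := by
  have hd' : (2 : ℝ) ≤ d := by exact_mod_cast hd
  have hp := one_sub_sq_pos ht
  simp only [legendreRHS_eq]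
  set g : ℝ := ((d : ℝ) - 1) / 2 with hg
  have hg0 : 0 < g := by rw [hg]; linarith
  have hdg : (d : ℝ) = 2 * g + 1 := by rw [hg]; ring
  have hn0 : (0 : ℝ) ≤ n := Nat.cast_nonneg n
  have e1 : ((d : ℝ) - 3) / 2 = g - 1 := by rw [hg]; ring
  rw [e1]
  have eG1 : Real.Gamma (((n + 1 : ℕ) : ℝ) + g) = (n + g) * Real.Gamma (n + g) := by
    rw [← Real.Gamma_add_one (by positivity)]
    push_cast; ring_nf
  have eG2 : Real.Gamma (((n + 2 : ℕ) : ℝ) + g) = (n + 1 + g) * ((n + g) * Real.Gamma (n + g)) := by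
    rw [← eG1, show (n : ℝ) + 1 + g = ((n + 1 : ℕ) : ℝ) + g by push_cast; ring,
      ← Real.Gamma_add_one (by positivity)]
    push_cast; ring_nf
  have hG : 0 < Real.Gamma (n + g) := Real.Gamma_pos_of_pos (by positivity)
  have r1 := rel_one n (n + g) ht
  have r2 := rel_two n (n + g - 1) ht
  rw [show (n : ℝ) + g - 1 + 2 = n + g + 1 by ring, show (n : ℝ) + g - 1 + 1 = n + g by ring] at r2
  have x2 : (((n + 2 : ℕ) : ℝ) + (g - 1)) = n + g + 1 := by push_cast; ring
  have x1 : (((n + 1 : ℕ) : ℝ) + (g - 1)) = n + g := by push_cast; ring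
  have x0 : ((n : ℝ) + (g - 1)) = n + g - 1 := by ring
  rw [eG1, eG2, x2, x1, x0]
  set F2 := iteratedDeriv (n + 2) (uu (n + g + 1)) t
  set F1 := iteratedDeriv (n + 1) (uu (n + g)) t
  set F0 := iteratedDeriv n (uu (n + g - 1)) t
  set H := iteratedDeriv n (uu (n + g)) t
  have key : (n + 2 * g) * F2 = -2 * (n + g + 1) * (2 * n + 2 * g + 1) * t * F1
      - 4 * (n + g + 1) * (n + g) * (n + 1) * F0 := by
    linear_combination (2 * n + 2 * g + 1) * r1 - (n + 1) * r2
  have hw : (1 - t ^ 2) ^ (-(g - 1)) ≠ 0 := (Real.rpow_pos_of_pos hp _).ne'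
  generalize (1 - t ^ 2) ^ (-(g - 1)) = w at hw
  generalize Real.Gamma g = Gg
  rw [hdg]
  have hne : (n : ℝ) + g ≠ 0 := by positivity
  have hne1 : (n : ℝ) + 1 + g ≠ 0 := by positivity
  field_simp
  have h4 : ((-1 : ℝ)) ^ (n + 2) = (-1) ^ n := by ring
  have h5 : ((-1 : ℝ)) ^ (n + 1) = - (-1) ^ n := by ring
  rw [h4, h5]
  linear_combination (-(-1) ^ n * Gg * 2 ^ (2 * n) * 2 : ℝ) * key

/-- Polynomial recurrence. -/
lemma poly_eq_of_Ioo {p q : Polynomial ℂ}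
    (h : ∀ t : ℝ, t ∈ Set.Ioo (-1 : ℝ) 1 → p.eval (t : ℂ) = q.eval (t : ℂ)) : p = q := by
  refine Polynomial.eq_of_infinite_eval_eq p q ?_
  have : (Complex.ofReal '' Set.Ioo (-1 : ℝ) 1) ⊆ {x | p.eval x = q.eval x} := by
    rintro _ ⟨t, ht, rfl⟩
    exact h t ht
  refine Set.Infinite.mono this ?_
  exact (Set.Ioo_infinite (by norm_num)).image Complex.ofReal_injective.injOn

lemma P_zero (d : ℕ) (hd : 2 ≤ d) (P : ℕ → Polynomial ℂ) (hP : ∀ ℓ : ℕ, IsLegendre d ℓ (P ℓ))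
    (s : ℂ) : (P 0).eval s = 1 := by
  have : P 0 = 1 := poly_eq_of_Ioo fun t ht => by
    rw [(hP 0).2 t ht, legendre_zero d hd ht]; simp
  rw [this]; simp

lemma P_one (d : ℕ) (hd : 2 ≤ d) (P : ℕ → Polynomial ℂ) (hP : ∀ ℓ : ℕ, IsLegendre d ℓ (P ℓ))
    (s : ℂ) : (P 1).eval s = s := by
  have : P 1 = Polynomial.X := poly_eq_of_Ioo fun t ht => by
    rw [(hP 1).2 t ht, legendre_one d hd ht]; simp
  rw [this]; simp

lemma P_rec (d : ℕ) (hd : 2 ≤ d) (P : ℕ → Polynomial ℂ) (hP : ∀ ℓ : ℕ, IsLegendre d ℓ (P ℓ))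
    (n : ℕ) (s : ℂ) : (2 * n + d) * (s * (P (n + 1)).eval s)
      = (n + d - 1) * (P (n + 2)).eval s + (n + 1) * (P n).eval s := by
  have : Polynomial.C (2 * n + d : ℂ) * (Polynomial.X * P (n + 1))
      = Polynomial.C (n + d - 1 : ℂ) * P (n + 2) + Polynomial.C (n + 1 : ℂ) * P n :=
    poly_eq_of_Ioo fun t ht => by
      simp only [Polynomial.eval_mul, Polynomial.eval_C, Polynomial.eval_X, Polynomial.eval_add]
      rw [(hP _).2 t ht, (hP _).2 t ht, (hP _).2 t ht]
      have := legendre_rec d hd n ht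
      exact_mod_cast congrArg Complex.ofReal this
  have h := congrArg (Polynomial.eval s) this
  simpa only [Polynomial.eval_mul, Polynomial.eval_C, Polynomial.eval_X, Polynomial.eval_add] using h

end FRR

namespace FRR

lemma Nld_zero (D : ℕ) : Nld (D + 2) 0 = 1 := by simp [Nld]

lemma Nld_one (D : ℕ) : Nld (D + 2) 1 = D + 2 := by
  simp [Nld]

lemma Nld_fact (D n : ℕ) :
    (Nld (D + 2) (n + 1) : ℂ) * ((n + 1).factorial * D.factorial)
      = (2 * n + 2 + D) * (n + D).factorial := by
  rcases n with _ | n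
  · simp only [zero_add, Nld_one]
    push_cast
    simp only [Nat.factorial_one, Nat.cast_one]
    ring
  · have h0 : Nld (D + 2) (n + 1 + 1) = (n + 2 + (D + 1)).choose (n + 2) - (n + (D + 1)).choose n := by
      simp only [Nld, if_pos (show 2 ≤ n + 1 + 1 by omega)]
      rw [show n + 1 + 1 + (D + 2) - 3 = n + (D + 1) by omega, show n + 1 + 1 - 2 = n by omega,
        show n + 1 + 1 + (D + 2) - 1 = n + 2 + (D + 1) by omega]
    have hle : (n + (D + 1)).choose n ≤ (n + 2 + (D + 1)).choose (n + 2) := by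
      rw [Nat.choose_symm_add, Nat.choose_symm_add]
      exact Nat.choose_le_choose _ (by omega)
    rw [h0, Nat.cast_sub hle]
    have h1 : ((n + (D + 1)).choose n : ℂ) * n.factorial * (D + 1).factorial = (n + (D + 1)).factorial := by
      rw [Nat.choose_symm_add]
      exact_mod_cast Nat.add_choose_mul_factorial_mul_factorial n (D + 1)
    have h2 : ((n + 2 + (D + 1)).choose (n + 2) : ℂ) * (n + 2).factorial * (D + 1).factorial
        = (n + 2 + (D + 1)).factorial := by
      rw [Nat.choose_symm_add]
      exact_mod_cast Nat.add_choose_mul_factorial_mul_factorial (n + 2) (D + 1)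
    have e1 : (n + 2 + (D + 1)).factorial = (n + D + 3) * ((n + D + 2) * (n + D + 1).factorial) := by
      rw [show n + 2 + (D + 1) = n + D + 1 + 1 + 1 by ring, Nat.factorial_succ, Nat.factorial_succ]
    have e2 : (n + 2).factorial = (n + 2) * ((n + 1) * n.factorial) := by
      rw [Nat.factorial_succ, Nat.factorial_succ]
    have e3 : (D + 1).factorial = (D + 1) * D.factorial := Nat.factorial_succ D
    rw [show n + (D + 1) = n + D + 1 by ring] at h1 ⊢
    rw [e1, e2, e3] at h2
    rw [e3] at h1
    rw [show n + 1 + 1 = n + 2 by ring, e2, show n + 1 + D = n + D + 1 by ring]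
    push_cast at *
    have hD : (D + 1 : ℂ) ≠ 0 := by exact_mod_cast Nat.succ_ne_zero D
    apply mul_left_cancel₀ hD
    linear_combination h2 - (n + 2) * (n + 1) * h1

lemma Nld_rec (D n : ℕ) : ((2 * n + 2 + D) * (n + 2) : ℂ) * Nld (D + 2) (n + 2)
    = (2 * n + 4 + D) * (n + 1 + D) * Nld (D + 2) (n + 1) := by
  have h1 := Nld_fact D n
  have h2 := Nld_fact D (n + 1)
  rw [show n + 1 + 1 = n + 2 by ring, Nat.factorial_succ (n + 1),
    show n + 1 + D = n + D + 1 by ring, Nat.factorial_succ (n + D)] at h2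
  push_cast at *
  have hne : ((n + 1).factorial * D.factorial : ℂ) ≠ 0 := by
    exact_mod_cast mul_ne_zero (Nat.factorial_ne_zero _) (Nat.factorial_ne_zero _)
  apply mul_left_cancel₀ hne
  linear_combination (2 * n + 2 + D) * h2 - (2 * n + 4 + D) * (n + 1 + D) * h1

/-- Coefficient in the three-term recurrence. -/
noncomputable def bb (D n : ℕ) : ℂ := if n = 0 then 1 else (n + D) / (2 * n + D)

/-- The recurrence satisfied by `N_ℓ P_ℓ(s)`. -/
structure QRec (D : ℕ) (s : ℂ) (Q : ℕ → ℂ) : Prop where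
  zero : Q 0 = 1
  one : s * Q 0 = 1 / (D + 2) * Q 1
  step : ∀ n : ℕ, s * Q (n + 1) = (n + 2) / (2 * n + 4 + D) * Q (n + 2) + bb D n * Q n

lemma QRec_of (D : ℕ) (P : ℕ → Polynomial ℂ) (hP : ∀ ℓ : ℕ, IsLegendre (D + 2) ℓ (P ℓ))
    (s : ℂ) : QRec D s (fun ℓ => (Nld (D + 2) ℓ : ℂ) * (P ℓ).eval s) := by
  have hd : 2 ≤ D + 2 := by omega
  have hD : (D + 2 : ℂ) ≠ 0 := by exact_mod_cast (by omega : D + 2 ≠ 0)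
  refine ⟨?_, ?_, ?_⟩
  · simp [Nld_zero, P_zero _ hd P hP]
  · simp only [Nld_zero, Nld_one, P_zero _ hd P hP, P_one _ hd P hP]
    push_cast
    field_simp
  · intro n
    have h1 := P_rec _ hd P hP n s
    have h2 := Nld_rec D n
    have a1 : (2 * n + 4 + D : ℂ) ≠ 0 := by exact_mod_cast (by omega : 2 * n + 4 + D ≠ 0)
    have a2 : (2 * n + 2 + D : ℂ) ≠ 0 := by exact_mod_cast (by omega : 2 * n + 2 + D ≠ 0)
    have a3 : (n + 2 : ℂ) ≠ 0 := by exact_mod_cast (by omega : n + 2 ≠ 0)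
    have h3 : (n + 2) / (2 * n + 4 + D) * (Nld (D + 2) (n + 2) : ℂ)
      = (n + 1 + D) / (2 * n + 2 + D) * (Nld (D + 2) (n + 1)) := by
      rw [div_mul_eq_mul_div, div_mul_eq_mul_div, div_eq_div_iff a1 a2]
      linear_combination h2
    have h4 : bb D n * Nld (D + 2) n = (n + 1) / (2 * n + 2 + D) * (Nld (D + 2) (n + 1) : ℂ) := by
      unfold bb
      rcases n with _ | n
      · have a5 : (2 + D : ℂ) ≠ 0 := by rw [add_comm]; exact hD
        simp [Nld_zero, Nld_one]
        field_simp
        ring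
      · have h5 := Nld_rec D n
        push_cast at *
        have a4 : (2 * (n + 1) + D : ℂ) ≠ 0 := by exact_mod_cast (by omega : 2 * (n + 1) + D ≠ 0)
        rw [div_mul_eq_mul_div, div_mul_eq_mul_div, div_eq_div_iff a4 a2]
        linear_combination - h5
    push_cast at h1
    have h6 : s * (P (n + 1)).eval s = ((n + 1 + D) * (P (n + 2)).eval s + (n + 1) * (P n).eval s) / (2 * n + 2 + D) := by
      rw [eq_div_iff a2]
      linear_combination h1
    calc _ = (Nld (D + 2) (n + 1) : ℂ) * (s * (P (n + 1)).eval s) := by ring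
      _ = ((n + 1 + D) / (2 * n + 2 + D) * (Nld (D + 2) (n + 1))) * (P (n + 2)).eval s
          + ((n + 1) / (2 * n + 2 + D) * (Nld (D + 2) (n + 1) : ℂ)) * (P n).eval s := by
            rw [h6]; ring
      _ = _ := by rw [← h3, ← h4]; ring

lemma QRec.bound {D : ℕ} {s : ℂ} {Q : ℕ → ℂ} (h : QRec D s Q) (n : ℕ) :
    ‖Q n‖ ≤ ((D + 2) * (‖s‖ + 1)) ^ n := by
  set A : ℝ := (D + 2) * (‖s‖ + 1) with hA
  have hs := norm_nonneg s
  have hDr : (0 : ℝ) ≤ D := Nat.cast_nonneg D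
  have hA1 : 1 ≤ A := by rw [hA]; nlinarith
  have hD2 : (D + 2 : ℂ) ≠ 0 := by exact_mod_cast (by omega : D + 2 ≠ 0)
  have hb : ∀ n, ‖bb D n‖ ≤ 1 := by
    intro n
    unfold bb
    split_ifs with h0
    · simp
    · have e : ((n + D) / (2 * n + D) : ℂ) = (((n + D) / (2 * n + D) : ℝ) : ℂ) := by push_cast; rfl
      have hn : (0 : ℝ) < n := by exact_mod_cast Nat.pos_of_ne_zero h0
      rw [e, Complex.norm_real, Real.norm_of_nonneg (by positivity), div_le_one (by positivity)]
      linarith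
  induction n using Nat.strong_induction_on with
  | _ n ih =>
    rcases n with _ | _ | n
    · simp [h.zero]
    · have h1 : Q 1 = (D + 2) * s := by
        have := h.one
        rw [h.zero] at this
        field_simp at this
        linear_combination -this
      have e : ‖(D + 2 : ℂ)‖ = D + 2 := by
        have : (D + 2 : ℂ) = ((D + 2 : ℝ) : ℂ) := by push_cast; rfl
        rw [this, Complex.norm_real, Real.norm_of_nonneg (by positivity)]
      simp only [zero_add, pow_one]
      rw [h1, norm_mul, e, hA]
      nlinarith
    · have h1 := h.step n
      have i1 := ih (n + 1) (by omega)
      have i0 := ih n (by omega)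
      have a1 : (2 * n + 4 + D : ℂ) ≠ 0 := by exact_mod_cast (by omega : 2 * n + 4 + D ≠ 0)
      have a3 : (n + 2 : ℂ) ≠ 0 := by exact_mod_cast (by omega : n + 2 ≠ 0)
      have h2 : Q (n + 2) = (((2 * n + 4 + D) / (n + 2) : ℝ) : ℂ) * (s * Q (n + 1) - bb D n * Q n) := by
        rw [h1]
        push_cast
        field_simp
        ring
      have hr : (2 * n + 4 + D : ℝ) / (n + 2) ≤ D + 2 := by
        rw [div_le_iff₀ (by positivity)]
        nlinarith [mul_nonneg hDr (Nat.cast_nonneg (α := ℝ) n)]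
      have h3 : ‖s * Q (n + 1) - bb D n * Q n‖ ≤ ‖s‖ * A ^ (n + 1) + A ^ (n + 1) := by
        refine (norm_sub_le _ _).trans ?_
        rw [norm_mul, norm_mul]
        gcongr
        calc ‖bb D n‖ * ‖Q n‖ ≤ 1 * A ^ n := by gcongr; exact hb n
          _ ≤ A ^ (n + 1) := by rw [one_mul]; exact pow_le_pow_right₀ hA1 (by omega)
      rw [show n + 1 + 1 = n + 2 by ring, h2, norm_mul, Complex.norm_real,
        Real.norm_of_nonneg (by positivity)]
      calc _ ≤ (D + 2) * (‖s‖ * A ^ (n + 1) + A ^ (n + 1)) := by gcongr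
        _ = A ^ (n + 2) := by rw [pow_succ A (n + 1), hA]; ring

/-- Connection coefficients. -/
noncomputable def TT (D n l : ℕ) : ℂ :=
  if l ≤ n then (-1) ^ l / ((n - l).factorial * (n + l + D).factorial) else 0

lemma TT_rel_zero (D n : ℕ) :
    TT D n 0 - bb D 0 * TT D n 1 = ((n + 1) * (2 * n + 1 + D)) * TT D (n + 1) 0 := by
  have f0 : ∀ k : ℕ, (k.factorial : ℂ) ≠ 0 := fun k => by exact_mod_cast Nat.factorial_ne_zero k
  rcases n with _ | n
  · simp [TT, bb]
    rw [show 1 + D = D + 1 by ring, Nat.factorial_succ]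
    push_cast
    have a : (D + 1 : ℂ) ≠ 0 := by exact_mod_cast Nat.succ_ne_zero D
    have := f0 D
    field_simp
    ring
  · simp only [TT, bb, if_true, show 0 ≤ n + 1 + 1 by omega, show 0 ≤ n + 1 by omega,
      show 1 ≤ n + 1 by omega, Nat.add_zero, Nat.sub_zero, Nat.add_sub_cancel]
    rw [show n + 1 + 1 + D = n + D + 1 + 1 by ring, show n + 1 + D = n + D + 1 by ring]
    simp only [Nat.factorial_succ]
    push_cast
    have := f0 n
    have := f0 (n + D)
    have a1 : (n + 1 : ℂ) ≠ 0 := by exact_mod_cast Nat.succ_ne_zero n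
    have a2 : (n + 1 + 1 : ℂ) ≠ 0 := by exact_mod_cast Nat.succ_ne_zero (n + 1)
    have a3 : (n + D + 1 : ℂ) ≠ 0 := by exact_mod_cast Nat.succ_ne_zero (n + D)
    have a4 : (n + D + 1 + 1 : ℂ) ≠ 0 := by exact_mod_cast Nat.succ_ne_zero (n + D + 1)
    field_simp
    ring

lemma TT_rel_succ (D n l : ℕ) (hl : l ≤ n) :
    TT D n (l + 1) - (l + 1) / (2 * l + 2 + D) * TT D n l - bb D (l + 1) * TT D n (l + 2)
      = ((n + 1) * (2 * n + 1 + D)) * TT D (n + 1) (l + 1) := by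
  have f0 : ∀ k : ℕ, (k.factorial : ℂ) ≠ 0 := fun k => by exact_mod_cast Nat.factorial_ne_zero k
  obtain ⟨m, rfl⟩ := Nat.exists_eq_add_of_le hl
  obtain ⟨W, hW⟩ : ∃ W : ℂ, W = 2 * l + 2 + D := ⟨_, rfl⟩
  obtain ⟨Y, hY⟩ : ∃ Y : ℂ, Y = l + m + l + D + 1 := ⟨_, rfl⟩
  obtain ⟨Z, hZ⟩ : ∃ Z : ℂ, Z = l + m + l + D + 1 + 1 := ⟨_, rfl⟩
  have b0 : W ≠ 0 := by rw [hW]; exact_mod_cast (by omega : 2 * l + 2 + D ≠ 0)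
  have c1 : Y ≠ 0 := by rw [hY]; exact_mod_cast (by omega : l + m + l + D + 1 ≠ 0)
  have c2 : Z ≠ 0 := by rw [hZ]; exact_mod_cast (by omega : l + m + l + D + 1 + 1 ≠ 0)
  have hb : bb D (l + 1) = (l + 1 + D) / W := by
    rw [hW]; simp [bb]; ring
  have g0 := f0 (l + m + l + D)
  obtain ⟨G, hG⟩ : ∃ G : ℂ, G = (l + m + l + D).factorial := ⟨_, rfl⟩
  rw [← hG] at g0
  have t0 : TT D (l + m) l = (-1) ^ l / (m.factorial * G) := by
    simp [TT, hG]
  have t3 : TT D (l + m + 1) (l + 1) = - (-1) ^ l / (m.factorial * (Z * (Y * G))) := by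
    simp only [TT, if_pos (show l + 1 ≤ l + m + 1 by omega)]
    rw [show l + m + 1 - (l + 1) = m by omega, show l + m + 1 + (l + 1) + D = l + m + l + D + 1 + 1 by ring]
    rw [Nat.factorial_succ (l + m + l + D + 1), Nat.factorial_succ (l + m + l + D), hG, hZ, hY]
    push_cast
    ring
  have hD : (D : ℂ) = W - 2 - 2 * l := by rw [hW]; ring
  have hY' : Y = W + m - 1 := by rw [hW, hY]; ring
  have hZ' : Z = W + m := by rw [hW, hZ]; ring
  rcases m with _ | _ | m
  · have t1 : TT D (l + 0) (l + 1) = 0 := by simp [TT]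
    have t2 : TT D (l + 0) (l + 2) = 0 := by simp [TT]
    rw [t0, t1, t2, t3, ← hW]
    simp only [Nat.factorial_zero, Nat.cast_one, Nat.cast_zero, Nat.add_zero] at *
    rw [hD]
    field_simp
    rw [hZ', hY']
    ring
  · have t1 : TT D (l + (0 + 1)) (l + 1) = - (-1) ^ l / (Y * G) := by
      simp only [TT, if_pos (show l + 1 ≤ l + (0 + 1) by omega)]
      rw [show l + (0 + 1) - (l + 1) = 0 by omega, show l + (0 + 1) + (l + 1) + D = l + (0 + 1) + l + D + 1 by ring, Nat.factorial_succ (l + (0 + 1) + l + D), hY, hG]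
      push_cast
      simp only [Nat.factorial_zero]
      push_cast
      ring
    have t2 : TT D (l + (0 + 1)) (l + 2) = 0 := by simp [TT]
    rw [t0, t1, t2, t3, ← hW]
    simp only [zero_add, Nat.factorial_one] at *
    push_cast at hZ' hY' ⊢
    rw [hD]
    field_simp
    rw [hZ', hY']
    ring
  · have t1 : TT D (l + (m + 1 + 1)) (l + 1) = - (-1) ^ l / ((m + 1).factorial * (Y * G)) := by
      simp only [TT, if_pos (show l + 1 ≤ l + (m + 1 + 1) by omega)]
      rw [show l + (m + 1 + 1) - (l + 1) = m + 1 by omega, show l + (m + 1 + 1) + (l + 1) + D = l + (m + 1 + 1) + l + D + 1 by ring, Nat.factorial_succ (l + (m + 1 + 1) + l + D), hY, hG]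
      push_cast
      ring
    have t2 : TT D (l + (m + 1 + 1)) (l + 2) = (-1) ^ l / (m.factorial * (Z * (Y * G))) := by
      simp only [TT, if_pos (show l + 2 ≤ l + (m + 1 + 1) by omega)]
      rw [show l + (m + 1 + 1) - (l + 2) = m by omega, show l + (m + 1 + 1) + (l + 2) + D = l + (m + 1 + 1) + l + D + 1 + 1 by ring, Nat.factorial_succ (l + (m + 1 + 1) + l + D + 1), Nat.factorial_succ (l + (m + 1 + 1) + l + D), hZ, hY, hG]
      push_cast
      ring
    rw [t0, t1, t2, t3, hb, ← hW]
    rw [Nat.factorial_succ (m + 1), Nat.factorial_succ m]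
    have := f0 m
    have a1 : (m + 1 : ℂ) ≠ 0 := by exact_mod_cast Nat.succ_ne_zero m
    have a2 : (m + 1 + 1 : ℂ) ≠ 0 := by exact_mod_cast Nat.succ_ne_zero (m + 1)
    push_cast at hZ' hY' ⊢
    rw [hD]
    field_simp
    rw [hZ', hY']
    ring

/-- The connection identity, step form. -/
lemma conn_step {D : ℕ} {s : ℂ} {Q : ℕ → ℂ} (h : QRec D s Q) (n : ℕ) :
    (1 - s) * ∑ l ∈ Finset.range (n + 1), TT D n l * Q l
      = ((n + 1) * (2 * n + 1 + D)) * ∑ l ∈ Finset.range (n + 2), TT D (n + 1) l * Q l := by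
  have hz : ∀ l, n < l → TT D n l = 0 := fun l hl => by simp [TT, hl]
  have e1 : s * ∑ l ∈ Finset.range (n + 1), TT D n l * Q l
      = ∑ l ∈ Finset.range (n + 1), (l + 1) / (2 * l + 2 + D) * TT D n l * Q (l + 1)
        + ∑ l ∈ Finset.range n, bb D l * TT D n (l + 1) * Q l := by
    have h1 : ∀ l ∈ Finset.range n, s * (TT D n (l + 1) * Q (l + 1)) =
      ((l + 1 : ℕ) + 1) / (2 * (l + 1 : ℕ) + 2 + D) * TT D n (l + 1) * Q (l + 1 + 1) + bb D l * TT D n (l + 1) * Q l := by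
      intro l _
      have := h.step l
      push_cast
      linear_combination TT D n (l + 1) * this
    rw [Finset.mul_sum, Finset.sum_range_succ', Finset.sum_congr rfl h1, Finset.sum_add_distrib,
      Finset.sum_range_succ' (fun l => ((l : ℂ) + 1) / (2 * l + 2 + D) * TT D n l * Q (l + 1))]
    have := h.one
    push_cast
    simp only [mul_zero, zero_add]
    have e : s * (TT D n 0 * Q 0) = 1 / (2 + D) * TT D n 0 * Q 1 := by
      rw [show (2 + D : ℂ) = D + 2 by ring]
      linear_combination TT D n 0 * this
    rw [e]; ring
  have e2 : ∑ l ∈ Finset.range n, bb D l * TT D n (l + 1) * Q l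
      = ∑ l ∈ Finset.range (n + 2), bb D l * TT D n (l + 1) * Q l := by
    rw [Finset.sum_range_succ, Finset.sum_range_succ, hz (n + 1) (by omega), hz (n + 1 + 1) (by omega)]
    ring
  have e3 : ∑ l ∈ Finset.range (n + 1), TT D n l * Q l
      = ∑ l ∈ Finset.range (n + 2), TT D n l * Q l := by
    rw [Finset.sum_range_succ _ (n + 1), hz (n + 1) (by omega)]
    ring
  rw [sub_mul, one_mul, e1, e2, e3, Finset.sum_range_succ', Finset.sum_range_succ' _ (n + 1),
    Finset.sum_range_succ' _ (n + 1), mul_add, Finset.mul_sum]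
  have r0 := TT_rel_zero D n
  have r1 : ∀ l ∈ Finset.range (n + 1), ((n + 1) * (2 * n + 1 + D)) * (TT D (n + 1) (l + 1) * Q (l + 1))
     = TT D n (l + 1) * Q (l + 1) - (l + 1) / (2 * l + 2 + D) * TT D n l * Q (l + 1) - bb D (l + 1) * TT D n (l + 1 + 1) * Q (l + 1) := by
    intro l hl
    have := TT_rel_succ D n l (by simp at hl; omega)
    linear_combination - Q (l + 1) * this
  rw [Finset.sum_congr rfl r1, Finset.sum_sub_distrib, Finset.sum_sub_distrib]
  linear_combination Q 0 * r0

lemma conn {D : ℕ} {s : ℂ} {Q : ℕ → ℂ} (h : QRec D s Q) (n : ℕ) :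
    (Complex.Gamma (n + D / 2 + 1))⁻¹ * (2 * n + D).factorial * ∑ l ∈ Finset.range (n + 1), TT D n l * Q l
      = 2 ^ n * (1 - s) ^ n / (n.factorial * Complex.Gamma (D / 2 + 1)) := by
  have hG : ∀ n : ℕ, Complex.Gamma (n + D / 2 + 1) ≠ 0 := fun n => by
    apply Complex.Gamma_ne_zero_of_re_pos
    have : (n + D / 2 + 1 : ℂ) = ((n + D / 2 + 1 : ℝ) : ℂ) := by push_cast; rfl
    rw [this, Complex.ofReal_re]
    positivity
  induction n with
  | zero =>
    have := hG 0
    have f0 : (D.factorial : ℂ) ≠ 0 := by exact_mod_cast Nat.factorial_ne_zero D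
    simp [TT, h.zero] at this ⊢
    field_simp
  | succ n ih =>
    have hs := conn_step h n
    have a0 : (n + 1 : ℂ) ≠ 0 := by exact_mod_cast Nat.succ_ne_zero n
    have a1 : (2 * n + 1 + D : ℂ) ≠ 0 := by exact_mod_cast (by omega : 2 * n + 1 + D ≠ 0)
    have a2 : (2 * n + 2 + D : ℂ) ≠ 0 := by exact_mod_cast (by omega : 2 * n + 2 + D ≠ 0)
    have a3 : (n + D / 2 + 1 : ℂ) ≠ 0 := by
      intro h0; apply a2; linear_combination 2 * h0
    have f0 : (n.factorial : ℂ) ≠ 0 := by exact_mod_cast Nat.factorial_ne_zero n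
    have g1 := hG n
    have g0 := hG 0
    have e1 : Complex.Gamma ((n + 1 : ℕ) + D / 2 + 1) = (n + D / 2 + 1) * Complex.Gamma (n + D / 2 + 1) := by
      rw [← Complex.Gamma_add_one _ a3]
      push_cast; ring_nf
    have e2 : (2 * (n + 1) + D).factorial = (2 * n + D + 1 + 1) * ((2 * n + D + 1) * (2 * n + D).factorial) := by
      rw [show 2 * (n + 1) + D = 2 * n + D + 1 + 1 by ring, Nat.factorial_succ, Nat.factorial_succ]
    rw [e1, e2, Nat.factorial_succ]
    have hs' : ∑ l ∈ Finset.range (n + 1 + 1), TT D (n + 1) l * Q l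
      = ((1 - s) * ∑ l ∈ Finset.range (n + 1), TT D n l * Q l) / ((n + 1) * (2 * n + 1 + D)) := by
      rw [hs, mul_div_cancel_left₀ _ (mul_ne_zero a0 a1)]
    rw [hs']
    push_cast
    calc _ = 2 * (1 - s) / (n + 1) * ((Complex.Gamma (n + D / 2 + 1))⁻¹ * (2 * n + D).factorial * ∑ l ∈ Finset.range (n + 1), TT D n l * Q l) := by
          have a3' : (2 * n + D + 2 : ℂ) ≠ 0 := by intro h0; apply a2; linear_combination h0
          have a4 : (n + D / 2 + 1 : ℂ) = (2 * n + 2 + D) / 2 := by ring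
          have a5 : (2 * n + D + 1 : ℂ) ≠ 0 := by intro h0; apply a1; linear_combination h0
          rw [mul_inv, a4, show (2 * n + 2 + D : ℂ) = 2 * n + D + 1 + 1 by ring,
            show (2 * n + 1 + D : ℂ) = 2 * n + D + 1 by ring]
          have a6 : (2 * n + D + 1 + 1 : ℂ) ≠ 0 := by intro h0; apply a2; linear_combination h0
          generalize (2 * n + D + 1 + 1 : ℂ) = X at *
          generalize (2 * n + D + 1 : ℂ) = Y at *
          generalize Complex.Gamma _ = GG at *
          field_simp
      _ = _ := by
        rw [ih]
        field_simp
        ring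

end FRR

namespace FRR

lemma ne_of_re {μ : ℂ} (hμ : 0 ≤ μ.re) (i : ℕ) : μ + i + 1 ≠ 0 := by
  intro h
  have := congrArg Complex.re h
  simp at this
  have : (0 : ℝ) ≤ i := Nat.cast_nonneg i
  linarith

lemma Gne_of_re {μ : ℂ} (hμ : 0 ≤ μ.re) (i : ℕ) : Complex.Gamma (μ + i + 1) ≠ 0 := by
  apply Complex.Gamma_ne_zero_of_re_pos
  simp
  have : (0 : ℝ) ≤ i := Nat.cast_nonneg i
  linarith

lemma dp_Gamma {μ : ℂ} (hμ : 0 ≤ μ.re) (j : ℕ) : ∀ i : ℕ,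
    (descPochhammer ℤ j).smeval (μ + (i + j : ℕ)) * Complex.Gamma (μ + i + 1)
      = Complex.Gamma (μ + (i + j : ℕ) + 1) := by
  induction j with
  | zero => intro i; simp
  | succ j ih =>
    intro i
    have h := ih (i + 1)
    rw [show i + 1 + j = i + (j + 1) by ring] at h
    rw [← h, descPochhammer_succ_right, Polynomial.smeval_mul]
    have e : Complex.Gamma (μ + (i + 1 : ℕ) + 1) = (μ + i + 1) * Complex.Gamma (μ + i + 1) := by
      rw [← Complex.Gamma_add_one _ (ne_of_re hμ i)]
      push_cast; ring_nf
    rw [e]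
    simp only [Polynomial.smeval_sub, Polynomial.smeval_X, pow_one, Polynomial.smeval_natCast, pow_zero]
    push_cast
    simp
    ring

lemma choose_Gamma {μ : ℂ} (hμ : 0 ≤ μ.re) (i j : ℕ) :
    Ring.choose (μ + (i + j : ℕ)) j = Complex.Gamma (μ + (i + j : ℕ) + 1) * ((j.factorial : ℂ) * Complex.Gamma (μ + i + 1))⁻¹ := by
  have f0 : (j.factorial : ℂ) ≠ 0 := by exact_mod_cast Nat.factorial_ne_zero j
  have := Gne_of_re hμ i
  rw [← dp_Gamma hμ j i, Ring.choose_eq_smul, smul_eq_mul]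
  field_simp

lemma vander {μ : ℂ} (hμ : 0 ≤ μ.re) (N : ℕ) (hN : 2 * μ = N) (k : ℕ) :
    ∑ ij ∈ Finset.HasAntidiagonal.antidiagonal k, ((ij.1.factorial : ℂ) * Complex.Gamma (μ + ij.1 + 1))⁻¹
        * ((ij.2.factorial : ℂ) * Complex.Gamma (μ + ij.2 + 1))⁻¹
      = (N + 2 * k).factorial / (k.factorial * (N + k).factorial * Complex.Gamma (μ + k + 1) ^ 2) := by
  have h := Ring.add_choose_eq (r := μ + k) (s := μ + k) k (Commute.all _ _)
  have h1 : ∀ ij ∈ Finset.HasAntidiagonal.antidiagonal k, Ring.choose (μ + k) ij.1 * Ring.choose (μ + k) ij.2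
     = Complex.Gamma (μ + k + 1) ^ 2 * (((ij.1.factorial : ℂ) * Complex.Gamma (μ + ij.1 + 1))⁻¹
        * ((ij.2.factorial : ℂ) * Complex.Gamma (μ + ij.2 + 1))⁻¹) := by
    intro ij hij
    obtain ⟨i, j⟩ := ij
    simp only [Finset.HasAntidiagonal.mem_antidiagonal] at hij
    have e1 := choose_Gamma hμ i j
    have e2 := choose_Gamma hμ j i
    rw [add_comm j i] at e2
    rw [hij] at e1 e2
    simp only
    rw [e1, e2, mul_inv, mul_inv, mul_inv, mul_inv]
    ring
  rw [Finset.sum_congr rfl h1, ← Finset.mul_sum,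
    show μ + k + (μ + k) = ((N + 2 * k : ℕ) : ℂ) by push_cast; linear_combination hN,
    Ring.choose_natCast] at h
  have hc := Nat.choose_mul_factorial_mul_factorial (show k ≤ N + 2 * k by omega)
  rw [show N + 2 * k - k = N + k by omega] at hc
  have g := Gne_of_re hμ k
  have f0 : ∀ k : ℕ, (k.factorial : ℂ) ≠ 0 := fun k => by exact_mod_cast Nat.factorial_ne_zero k
  rw [eq_div_iff (mul_ne_zero (mul_ne_zero (f0 _) (f0 _)) (pow_ne_zero _ g)), ← hc]
  push_cast
  rw [h]
  ring

lemma Gamma_lb (x : ℝ) (hx : 0 ≤ x) (n : ℕ) :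
    Real.Gamma (x + 1) * n.factorial ≤ Real.Gamma (x + n + 1) := by
  induction n with
  | zero => simp
  | succ n ih =>
    have hp : 0 < Real.Gamma (x + n + 1) := Real.Gamma_pos_of_pos (by positivity)
    rw [show x + (n + 1 : ℕ) + 1 = (x + n + 1) + 1 by push_cast; ring,
      Real.Gamma_add_one (s := x + n + 1) (by positivity), Nat.factorial_succ]
    push_cast
    calc _ = (n + 1 : ℝ) * (Real.Gamma (x + 1) * n.factorial) := by ring
      _ ≤ (x + n + 1) * Real.Gamma (x + n + 1) := by
        gcongr
        linarith

/-- Coefficients of the squared function. -/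
noncomputable def EE (D n : ℕ) : ℂ :=
  (-1) ^ n * (2 * n + D).factorial / (2 ^ D * 4 ^ n * Complex.Gamma (n + D / 2 + 1) ^ 2)

lemma phiF_eq (D ℓ : ℕ) (z : ℂ) : phiF (D + 2) ℓ z =
    z ^ ℓ / (2 : ℂ) ^ ((ℓ : ℂ) + D / 2) *
    ∑' n : ℕ, (((n.factorial : ℂ) * Complex.Gamma ((ℓ : ℂ) + D / 2 + n + 1))⁻¹) * (-(z / 2) ^ 2) ^ n := by
  unfold phiF
  push_cast
  rw [show ((D : ℂ) + 2 - 2) = D by ring]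
  congr 1
  apply tsum_congr
  intro n
  rw [neg_pow ((z / 2) ^ 2) n, pow_mul]
  ring

lemma re_mu (D ℓ : ℕ) : 0 ≤ ((ℓ : ℂ) + D / 2).re := by
  have : ((ℓ : ℂ) + D / 2) = ((ℓ + D / 2 : ℝ) : ℂ) := by push_cast; rfl
  rw [this, Complex.ofReal_re]
  positivity

lemma norm_Gamma (D ℓ : ℕ) : ‖Complex.Gamma (ℓ + D / 2 + 1)‖ = Real.Gamma (ℓ + D / 2 + 1) := by
  have : ((ℓ : ℂ) + D / 2 + 1) = ((ℓ + D / 2 + 1 : ℝ) : ℂ) := by push_cast; rfl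
  rw [this, Complex.Gamma_ofReal, Complex.norm_real, Real.norm_of_nonneg]
  exact (Real.Gamma_pos_of_pos (by positivity)).le

lemma summ_phi (D ℓ : ℕ) (w : ℂ) :
    Summable (fun n : ℕ => ‖(((n.factorial : ℂ) * Complex.Gamma ((ℓ : ℂ) + D / 2 + n + 1))⁻¹) * w ^ n‖) := by
  have hG0 : 0 < Real.Gamma (ℓ + D / 2 + 1) := Real.Gamma_pos_of_pos (by positivity)
  refine Summable.of_nonneg_of_le (fun _ => norm_nonneg _) (fun n => ?_)
    ((Real.summable_pow_div_factorial ‖w‖).mul_left (Real.Gamma (ℓ + D / 2 + 1))⁻¹)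
  have e : ((ℓ : ℂ) + D / 2 + n + 1) = (ℓ + n : ℕ) + D / 2 + 1 := by push_cast; ring
  rw [e, norm_mul, norm_inv, norm_mul, norm_pow, Complex.norm_natCast, norm_Gamma]
  have h1 := Gamma_lb (ℓ + D / 2) (by positivity) n
  have h2 : Real.Gamma (ℓ + D / 2 + 1) ≤ Real.Gamma ((ℓ + n : ℕ) + D / 2 + 1) := by
    push_cast
    rw [show (ℓ + n + D / 2 + 1 : ℝ) = ℓ + D / 2 + n + 1 by ring]
    refine le_trans ?_ h1
    exact le_mul_of_one_le_right hG0.le (by exact_mod_cast Nat.factorial_pos n)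
  have f0 : (0 : ℝ) < n.factorial := by exact_mod_cast Nat.factorial_pos n
  calc _ ≤ ((n.factorial : ℝ) * Real.Gamma (ℓ + D / 2 + 1))⁻¹ * ‖w‖ ^ n := by gcongr
    _ = _ := by rw [mul_inv]; ring

lemma phiF_sq (D ℓ : ℕ) (z : ℂ) :
    HasSum (fun k : ℕ => EE D (ℓ + k) * TT D (ℓ + k) ℓ * (z ^ 2) ^ (ℓ + k)) (phiF (D + 2) ℓ z ^ 2) := by
  have hμ := re_mu D ℓ
  have hs := summ_phi D ℓ (-(z / 2) ^ 2)
  have h1 := tsum_mul_tsum_eq_tsum_sum_antidiagonal_of_summable_norm hs hs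
  have h2 := (summable_norm_sum_mul_antidiagonal_of_summable_norm hs hs).of_norm.hasSum
  rw [← h1, ← sq] at h2
  have h3 := h2.mul_left ((z ^ ℓ / (2 : ℂ) ^ ((ℓ : ℂ) + D / 2)) ^ 2)
  rw [phiF_eq, mul_pow]
  convert! h3 using 1
  funext k
  have hv := vander hμ (2 * ℓ + D) (by push_cast; ring) k
  have h4 : ∀ kl ∈ Finset.HasAntidiagonal.antidiagonal k, ((((kl.1.factorial : ℂ) * Complex.Gamma ((ℓ : ℂ) + D / 2 + kl.1 + 1))⁻¹) * (-(z / 2) ^ 2) ^ kl.1)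
     * ((((kl.2.factorial : ℂ) * Complex.Gamma ((ℓ : ℂ) + D / 2 + kl.2 + 1))⁻¹) * (-(z / 2) ^ 2) ^ kl.2)
     = (-(z / 2) ^ 2) ^ k * (((kl.1.factorial : ℂ) * Complex.Gamma ((ℓ : ℂ) + D / 2 + kl.1 + 1))⁻¹
        * ((kl.2.factorial : ℂ) * Complex.Gamma ((ℓ : ℂ) + D / 2 + kl.2 + 1))⁻¹) := by
    intro kl hkl
    rw [← Finset.HasAntidiagonal.mem_antidiagonal.mp hkl, pow_add]
    ring
  rw [Finset.sum_congr rfl h4, ← Finset.mul_sum, hv]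
  have e1 : ((2 : ℂ) ^ ((ℓ : ℂ) + D / 2)) ^ 2 = 2 ^ (2 * ℓ + D) := by
    rw [← Complex.cpow_nat_mul, ← Complex.cpow_natCast]
    congr 1
    push_cast; ring
  have e2 : ((ℓ + k : ℕ) : ℂ) + D / 2 + 1 = ℓ + D / 2 + k + 1 := by push_cast; ring
  have g := Gne_of_re hμ k
  simp only [EE, TT, if_pos (show ℓ ≤ ℓ + k by omega), e2]
  rw [div_pow, e1, show 2 * (ℓ + k) + D = 2 * ℓ + D + 2 * k by ring,
    show ℓ + k + ℓ + D = 2 * ℓ + D + k by ring, show ℓ + k - ℓ = k by omega]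
  generalize Complex.Gamma _ = G at *
  have f0 : ∀ k : ℕ, (k.factorial : ℂ) ≠ 0 := fun k => by exact_mod_cast Nat.factorial_ne_zero k
  have f1 := f0 k
  have f2 := f0 (2 * ℓ + D + k)
  generalize ((2 * ℓ + D + k).factorial : ℂ) = F1 at *
  generalize ((2 * ℓ + D + 2 * k).factorial : ℂ) = F2 at *
  have e3 : (-(z / 2) ^ 2) ^ k = (-1) ^ k * (z ^ 2) ^ k / 4 ^ k := by
    rw [neg_pow, div_pow, div_pow]; norm_num; ring
  have e4 : ((-1 : ℂ) ^ ℓ) * (-1) ^ ℓ = 1 := by rw [← mul_pow]; norm_num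
  have e5 : (4 : ℂ) ^ ℓ = 2 ^ (2 * ℓ) := by rw [pow_mul]; norm_num
  rw [e3, pow_add (-1 : ℂ), pow_add (4 : ℂ), pow_add (2 : ℂ), e5, pow_add (z ^ 2)]
  have : (2 : ℂ) ^ (2 * ℓ) ≠ 0 := pow_ne_zero _ two_ne_zero
  field_simp
  linear_combination F2 * (z ^ 2) ^ ℓ * (z ^ 2) ^ k * e4

end FRR

namespace FRR

open Metric Set in
lemma polar {d : ℕ} (hd : 1 ≤ d) (m : ℕ) (h : EuclideanSpace ℝ (Fin d) → ℂ)
    (hh : ∀ (r : ℝ), 0 ≤ r → ∀ (x : EuclideanSpace ℝ (Fin d)), h (r • x) = (r : ℂ) ^ m * h x) (g : ℝ → ℂ) :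
    ∫ x : EuclideanSpace ℝ (Fin d), g ‖x‖ * h x
      = (∫ u : sphere (0 : EuclideanSpace ℝ (Fin d)) 1, h u ∂(Measure.toSphere volume)) *
        ∫ r : Ioi (0 : ℝ), g r * (r : ℂ) ^ m ∂(Measure.volumeIoiPow (Module.finrank ℝ (EuclideanSpace ℝ (Fin d)) - 1)) := by
  have : Nonempty (Fin d) := ⟨⟨0, hd⟩⟩
  rw [← integral_prod_mul]
  calc
    ∫ x : EuclideanSpace ℝ (Fin d), g ‖x‖ * h x
      = ∫ x : ({(0)}ᶜ : Set (EuclideanSpace ℝ (Fin d))), g ‖x.1‖ * h x.1 ∂(volume.comap Subtype.val) := by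
      rw [integral_subtype_comap (measurableSet_singleton _).compl fun x ↦ g ‖x‖ * h x]
      rw [restrict_compl_singleton]
    _ = _ := by
      rw [← (Measure.measurePreserving_homeomorphUnitSphereProd
        (volume : Measure (EuclideanSpace ℝ (Fin d)))).integral_comp
        (Homeomorph.measurableEmbedding _)]
      apply integral_congr_ae
      refine Filter.Eventually.of_forall ?_
      intro x
      have hx : ‖(x : EuclideanSpace ℝ (Fin d))‖ ≠ 0 := by
        rw [norm_ne_zero_iff]; exact x.2
      have e := hh ‖(x : EuclideanSpace ℝ (Fin d))‖ (norm_nonneg _) (‖(x : EuclideanSpace ℝ (Fin d))‖⁻¹ • x.1)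
      rw [smul_inv_smul₀ hx] at e
      simp only [homeomorphUnitSphereProd_apply_snd_coe, homeomorphUnitSphereProd_apply_fst_coe]
      rw [e]
      ring

lemma polar_cross {d : ℕ} (hd : 1 ≤ d) (m : ℕ) (h : EuclideanSpace ℝ (Fin d) → ℂ)
    (hh : ∀ (r : ℝ), 0 ≤ r → ∀ (x : EuclideanSpace ℝ (Fin d)), h (r • x) = (r : ℂ) ^ m * h x) (g g' : ℝ → ℂ) :
    (∫ x : EuclideanSpace ℝ (Fin d), g ‖x‖ * h x) * (∫ x : EuclideanSpace ℝ (Fin d), g' ‖x‖ * (‖x‖ : ℂ) ^ m)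
    = (∫ x : EuclideanSpace ℝ (Fin d), g' ‖x‖ * h x) * (∫ x : EuclideanSpace ℝ (Fin d), g ‖x‖ * (‖x‖ : ℂ) ^ m) := by
  have hn : ∀ (r : ℝ), 0 ≤ r → ∀ (x : EuclideanSpace ℝ (Fin d)), ((‖r • x‖ : ℝ) : ℂ) ^ m = (r : ℂ) ^ m * (‖x‖ : ℂ) ^ m := by
    intro r hr x
    rw [norm_smul, Real.norm_of_nonneg hr]
    push_cast
    ring
  rw [polar hd m h hh g, polar hd m h hh g', polar hd m _ hn g, polar hd m _ hn g']
  ring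

lemma series_uniq {a b : ℕ → ℂ} {F : ℂ → ℂ} (ha : ∀ t, HasSum (fun n => a n * t ^ n) (F t))
    (hb : ∀ t, HasSum (fun n => b n * t ^ n) (F t)) (n : ℕ) : a n = b n := by
  have key : ∀ c : ℕ → ℂ, (∀ t, HasSum (fun n => c n * t ^ n) (F t)) →
      HasFPowerSeriesAt F (FormalMultilinearSeries.ofScalars ℂ c) 0 := by
    intro c hc
    rw [hasFPowerSeriesAt_iff]
    refine Filter.Eventually.of_forall fun z => ?_
    have := hc z
    simpa [FormalMultilinearSeries.coeff_ofScalars, mul_comm] using this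
  have h := (key a ha).eq_formalMultilinearSeries (key b hb)
  have h2 := congrArg (fun p => p.coeff n) h
  simpa [FormalMultilinearSeries.coeff_ofScalars] using h2

lemma expand {d : ℕ} (g : EuclideanSpace ℝ (Fin d) → ℂ) (hm : AEStronglyMeasurable g)
    (hg : ∀ c : ℝ, Integrable (fun x => ‖g x‖ * Real.exp (c * ‖x‖)))
    (z : ℂ) (ξ : EuclideanSpace ℝ (Fin d)) :
    HasSum (fun m : ℕ => (∫ x, g x * ((⟪ξ, x⟫ : ℝ) : ℂ) ^ m) * (z ^ m / m.factorial))
      (∫ x, g x * Complex.exp (z * (⟪ξ, x⟫ : ℝ))) := by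
  have h := hasSum_integral_of_dominated_convergence (μ := volume)
    (F := fun (m : ℕ) (x : EuclideanSpace ℝ (Fin d)) => g x * ((z * (⟪ξ, x⟫ : ℝ)) ^ m / m.factorial))
    (f := fun x => g x * Complex.exp (z * (⟪ξ, x⟫ : ℝ)))
    (fun m x => ‖g x‖ * (((‖z‖ * ‖ξ‖) * ‖x‖) ^ m / m.factorial)) ?_ ?_ ?_ ?_ ?_
  · convert! h using 2 with m
    rw [← integral_mul_const]
    congr 1
    funext x
    rw [mul_pow]
    ring
  · intro m
    refine hm.mul ?_
    apply Continuous.aestronglyMeasurable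
    fun_prop
  · intro m
    refine Filter.Eventually.of_forall fun x => ?_
    rw [norm_mul, norm_div, norm_pow, norm_mul, Complex.norm_natCast, Complex.norm_real, mul_assoc]
    gcongr
    exact norm_inner_le_norm ξ x
  · exact Filter.Eventually.of_forall fun x => (Real.summable_pow_div_factorial _).mul_left _
  · convert! hg (‖z‖ * ‖ξ‖) using 2 with x
    rw [tsum_mul_left, Real.exp_eq_exp_ℝ, NormedSpace.exp_eq_tsum_div]
  · refine Filter.Eventually.of_forall fun x => ?_
    have := NormedSpace.expSeries_div_hasSum_exp (z * (⟪ξ, x⟫ : ℝ))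
    rw [← Complex.exp_eq_exp_ℂ] at this
    exact this.mul_left _

lemma gauss_int (d : ℕ) (c : ℝ) : Integrable (fun x : EuclideanSpace ℝ (Fin d) =>
    ‖Complex.exp (-(‖x‖ : ℂ) ^ 2)‖ * Real.exp (c * ‖x‖)) := by
  have h := (GaussianFourier.integrable_cexp_neg_mul_sq_norm_add (b := 1 / 2) (by norm_num) 0
    (0 : EuclideanSpace ℝ (Fin d))).norm.const_mul (Real.exp (c ^ 2 / 2))
  refine h.mono' ?_ ?_
  · apply Continuous.aestronglyMeasurable
    fun_prop
  · refine Filter.Eventually.of_forall fun x => ?_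
    rw [Real.norm_of_nonneg (by positivity), Complex.norm_exp, Complex.norm_exp, ← Real.exp_add,
      ← Real.exp_add]
    apply Real.exp_le_exp.mpr
    have e1 : (-(‖x‖ : ℂ) ^ 2).re = - ‖x‖ ^ 2 := by
      have : (-(‖x‖ : ℂ) ^ 2) = ((- ‖x‖ ^ 2 : ℝ) : ℂ) := by push_cast; rfl
      rw [this, Complex.ofReal_re]
    have e2 : (-(1 / 2 : ℂ) * (‖x‖ : ℂ) ^ 2 + 0 * (⟪0, x⟫ : ℝ)).re = - ‖x‖ ^ 2 / 2 := by
      have : (-(1 / 2 : ℂ) * (‖x‖ : ℂ) ^ 2 + 0 * (⟪0, x⟫ : ℝ)) = ((- ‖x‖ ^ 2 / 2 : ℝ) : ℂ) := by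
        push_cast; ring
      rw [this, Complex.ofReal_re]
    rw [e1, e2]
    nlinarith [sq_nonneg (c - ‖x‖)]

lemma hasSum_even {b : ℕ → ℂ} {S : ℂ} (hodd : ∀ n, b (2 * n + 1) = 0) :
    HasSum (fun n => b (2 * n)) S ↔ HasSum b S := by
  have hi : Function.Injective (fun n : ℕ => 2 * n) := fun a b h => by simpa using h
  refine hi.hasSum_iff (f := b) ?_
  intro x hx
  rcases Nat.even_or_odd' x with ⟨k, rfl | rfl⟩
  · exact absurd ⟨k, rfl⟩ hx
  · exact hodd k

/-- Gaussian directional moments. -/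
noncomputable def gm (d : ℕ) (ξ : EuclideanSpace ℝ (Fin d)) (m : ℕ) : ℂ :=
  ∫ x : EuclideanSpace ℝ (Fin d), Complex.exp (-(‖x‖ : ℂ) ^ 2) * ((⟪ξ, x⟫ : ℝ) : ℂ) ^ m

lemma gm_aux (d : ℕ) (ξ : EuclideanSpace ℝ (Fin d)) (m : ℕ) :
    gm d ξ m / m.factorial = if Even m then (Real.pi : ℂ) ^ (d / 2 : ℂ) * ((‖ξ‖ : ℂ) ^ 2 / 4) ^ (m / 2) / (m / 2).factorial else 0 := by
  refine series_uniq (F := fun t => (Real.pi : ℂ) ^ (d / 2 : ℂ) * Complex.exp (t ^ 2 * ‖ξ‖ ^ 2 / 4))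
    (a := fun m => gm d ξ m / m.factorial) (b := fun m => if Even m then (Real.pi : ℂ) ^ (d / 2 : ℂ) * ((‖ξ‖ : ℂ) ^ 2 / 4) ^ (m / 2) / (m / 2).factorial else 0) ?_ ?_ m
  · intro t
    have h := expand (fun x : EuclideanSpace ℝ (Fin d) => Complex.exp (-(‖x‖ : ℂ) ^ 2))
      (by apply Continuous.aestronglyMeasurable; fun_prop) (gauss_int d) t ξ
    have h2 := GaussianFourier.integral_cexp_neg_mul_sq_norm_add (b := 1) (by norm_num) t ξ
    convert! h using 1
    · funext m
      simp only [gm]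
      ring
    · simp only [div_one, mul_one, finrank_euclideanSpace, Fintype.card_fin] at h2
      rw [← h2]
      congr 1
      funext x
      rw [← Complex.exp_add]
      congr 1
      ring
  · intro t
    rw [← hasSum_even]
    · have := NormedSpace.expSeries_div_hasSum_exp (t ^ 2 * ‖ξ‖ ^ 2 / 4 : ℂ)
      rw [← Complex.exp_eq_exp_ℂ] at this
      convert! this.mul_left ((Real.pi : ℂ) ^ (d / 2 : ℂ)) using 1
      funext n
      simp only [even_two, Even.mul_right, if_true, Nat.mul_div_cancel_left n two_pos]
      rw [pow_mul, div_pow, div_pow, mul_pow]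
      ring
    · intro n
      simp

lemma gm_odd (d : ℕ) (ξ : EuclideanSpace ℝ (Fin d)) (n : ℕ) : gm d ξ (2 * n + 1) = 0 := by
  have h := gm_aux d ξ (2 * n + 1)
  rw [if_neg (by simp), div_eq_zero_iff] at h
  rcases h with h | h
  · exact h
  · exact absurd h (by exact_mod_cast Nat.factorial_ne_zero _)

lemma gm_even (d : ℕ) (ξ : EuclideanSpace ℝ (Fin d)) (n : ℕ) : gm d ξ (2 * n) =
    (Real.pi : ℂ) ^ (d / 2 : ℂ) * (‖ξ‖ : ℂ) ^ (2 * n) / 4 ^ n / n.factorial * (2 * n).factorial := by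
  have h := gm_aux d ξ (2 * n)
  have f0 : ((2 * n).factorial : ℂ) ≠ 0 := by exact_mod_cast Nat.factorial_ne_zero _
  rw [if_pos (by simp), Nat.mul_div_cancel_left n two_pos, div_eq_iff f0] at h
  rw [h, div_pow, pow_mul]
  ring

/-- Gaussian radial moments. -/
noncomputable def jm (d m : ℕ) : ℂ :=
  ∫ x : EuclideanSpace ℝ (Fin d), Complex.exp (-(‖x‖ : ℂ) ^ 2) * (‖x‖ : ℂ) ^ m

lemma jm_aux (d : ℕ) (hd : 1 ≤ d) : ∃ K : ℂ, ∀ m : ℕ, jm d m = K * Complex.Gamma ((d + m) / 2) := by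
  have : Nonempty (Fin d) := ⟨⟨0, hd⟩⟩
  refine ⟨d * (volume : Measure (EuclideanSpace ℝ (Fin d))).real (Metric.ball 0 1) / 2, fun m => ?_⟩
  have h := integral_fun_norm_addHaar (volume : Measure (EuclideanSpace ℝ (Fin d)))
    (fun r : ℝ => Complex.exp (-(r : ℂ) ^ 2) * (r : ℂ) ^ m)
  unfold jm
  rw [h]
  have h2 := integral_rpow_mul_exp_neg_rpow (p := 2) (q := d - 1 + m) (by norm_num)
    (by have : (1 : ℝ) ≤ d := by exact_mod_cast hd
        have : (0 : ℝ) ≤ m := Nat.cast_nonneg m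
        linarith)
  have e : ∫ y in Set.Ioi (0 : ℝ), y ^ (Module.finrank ℝ (EuclideanSpace ℝ (Fin d)) - 1) • (Complex.exp (-(y : ℂ) ^ 2) * (y : ℂ) ^ m)
    = ((∫ y in Set.Ioi (0 : ℝ), y ^ ((d : ℝ) - 1 + m) * Real.exp (- y ^ (2 : ℝ)) : ℝ) : ℂ) := by
    rw [← integral_complex_ofReal]
    refine setIntegral_congr_fun measurableSet_Ioi fun y hy => ?_
    have hy' : (0 : ℝ) < y := hy
    simp only [finrank_euclideanSpace, Fintype.card_fin]
    rw [show ((d : ℝ) - 1 + m) = ((d - 1 + m : ℕ) : ℝ) by push_cast [Nat.cast_sub hd]; ring,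
      Real.rpow_natCast, Real.rpow_two, pow_add, Complex.real_smul]
    push_cast
    ring
  rw [e, h2]
  simp only [finrank_euclideanSpace, Fintype.card_fin, nsmul_eq_mul, Complex.real_smul]
  push_cast
  rw [← Complex.Gamma_ofReal]
  push_cast
  rw [show ((d : ℂ) - 1 + m + 1) = d + m by ring]
  ring

lemma jm_eq (d : ℕ) (hd : 1 ≤ d) (m : ℕ) :
    jm d m = (Real.pi : ℂ) ^ (d / 2 : ℂ) * Complex.Gamma ((d + m) / 2) / Complex.Gamma (d / 2) := by
  obtain ⟨K, hK⟩ := jm_aux d hd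
  have h0 : jm d 0 = (Real.pi : ℂ) ^ (d / 2 : ℂ) := by
    have := gm_even d 0 0
    simpa [gm, jm] using this
  have h1 := hK 0
  have hG : Complex.Gamma (d / 2 : ℂ) ≠ 0 := by
    apply Complex.Gamma_ne_zero_of_re_pos
    have : (d / 2 : ℂ) = ((d / 2 : ℝ) : ℂ) := by push_cast; rfl
    rw [this, Complex.ofReal_re]
    have : (1 : ℝ) ≤ d := by exact_mod_cast hd
    positivity
  rw [h0] at h1
  rw [hK m, h1]
  push_cast
  rw [add_zero]
  field_simp

/-- The Fourier side. -/
lemma fourier_side {d : ℕ} (hd : 1 ≤ d) (f : EuclideanSpace ℝ (Fin d) → ℂ) (hf : Integrable f)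
    (f₀ : ℝ → ℂ) (hrad : ∀ᵐ x : EuclideanSpace ℝ (Fin d), f x = f₀ ‖x‖)
    (ρ : ℝ) (hsupp : ∀ᵐ x : EuclideanSpace ℝ (Fin d), ρ ≤ ‖x‖ → f x = 0)
    (ξ : EuclideanSpace ℝ (Fin d)) :
    HasSum (fun n : ℕ => (-1) ^ n * (‖ξ‖ : ℂ) ^ (2 * n) / (4 ^ n * n.factorial)
        * Complex.Gamma (d / 2) / Complex.Gamma (n + d / 2) * ∫ x, f x * (‖x‖ : ℂ) ^ (2 * n))
      (∫ x : EuclideanSpace ℝ (Fin d), f x * Complex.exp (-Complex.I * (⟪ξ, x⟫ : ℝ))) := by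
  have hGp : ∀ m : ℕ, Complex.Gamma ((d + m) / 2) ≠ 0 := by
    intro m
    apply Complex.Gamma_ne_zero_of_re_pos
    have : ((d + m) / 2 : ℂ) = (((d + m) / 2 : ℝ) : ℂ) := by push_cast; rfl
    rw [this, Complex.ofReal_re]
    have : (1 : ℝ) ≤ d := by exact_mod_cast hd
    positivity
  have hpi : (Real.pi : ℂ) ^ (d / 2 : ℂ) ≠ 0 := by
    rw [Complex.cpow_ne_zero_iff]
    left
    exact_mod_cast Real.pi_ne_zero
  have hG0 : Complex.Gamma (d / 2 : ℂ) ≠ 0 := by simpa using hGp 0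
  have hj : ∀ m, jm d m ≠ 0 := by
    intro m
    rw [jm_eq d hd]
    exact div_ne_zero (mul_ne_zero hpi (hGp m)) hG0
  have hg : ∀ c : ℝ, Integrable (fun x => ‖f x‖ * Real.exp (c * ‖x‖)) := by
    intro c
    refine (hf.norm.mul_const (Real.exp (|c| * |ρ|))).mono' ?_ ?_
    · refine hf.norm.aestronglyMeasurable.mul ?_
      apply Continuous.aestronglyMeasurable
      fun_prop
    · filter_upwards [hsupp] with x hx
      rw [Real.norm_of_nonneg (by positivity)]
      by_cases h : ρ ≤ ‖x‖
      · simp [hx h]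
      · push Not at h
        gcongr
        · exact le_abs_self c
        · exact h.le.trans (le_abs_self ρ)
  have hmom : ∀ m : ℕ, (∫ x, f x * ((⟪ξ, x⟫ : ℝ) : ℂ) ^ m) = gm d ξ m * (∫ x, f x * (‖x‖ : ℂ) ^ m) / jm d m := by
    intro m
    have h := polar_cross hd m (fun x => ((⟪ξ, x⟫ : ℝ) : ℂ) ^ m)
      (fun r _ x => by rw [real_inner_smul_right]; push_cast; ring) f₀ (fun r => Complex.exp (-(r : ℂ) ^ 2))
    rw [eq_div_iff (hj m)]
    have e1 : (∫ x, f x * ((⟪ξ, x⟫ : ℝ) : ℂ) ^ m) = ∫ x : EuclideanSpace ℝ (Fin d), f₀ ‖x‖ * ((⟪ξ, x⟫ : ℝ) : ℂ) ^ m := by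
      apply integral_congr_ae
      filter_upwards [hrad] with x hx
      rw [hx]
    have e2 : (∫ x, f x * (‖x‖ : ℂ) ^ m) = ∫ x : EuclideanSpace ℝ (Fin d), f₀ ‖x‖ * (‖x‖ : ℂ) ^ m := by
      apply integral_congr_ae
      filter_upwards [hrad] with x hx
      rw [hx]
    rw [e1, e2]
    exact h
  have h := expand f hf.aestronglyMeasurable hg (-Complex.I) ξ
  simp only [hmom] at h
  rw [← hasSum_even (fun n => by rw [gm_odd]; simp)] at h
  convert! h using 1
  funext n
  rw [gm_even, jm_eq d hd]
  have e1 : ((d : ℂ) + (2 * n : ℕ)) / 2 = n + d / 2 := by push_cast; ring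
  have g1 := hGp (2 * n)
  rw [e1] at g1 ⊢
  have f0 : ∀ k : ℕ, (k.factorial : ℂ) ≠ 0 := fun k => by exact_mod_cast Nat.factorial_ne_zero k
  have f1 := f0 n
  have f2 := f0 (2 * n)
  have e3 : (-Complex.I) ^ (2 * n) = (-1) ^ n := by
    rw [pow_mul, neg_sq, Complex.I_sq]
  rw [e3]
  field_simp

end FRR

namespace FRR

lemma ET_bound (D l k : ℕ) : ‖EE D (l + k) * TT D (l + k) l‖
    ≤ (Real.Gamma (D / 2 + 1) ^ 2)⁻¹ * (((l.factorial : ℝ))⁻¹ * ((k.factorial : ℝ))⁻¹) := by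
  have hG0 : 0 < Real.Gamma (D / 2 + 1) := Real.Gamma_pos_of_pos (by positivity)
  have f0 : ∀ k : ℕ, (0 : ℝ) < k.factorial := fun k => by exact_mod_cast Nat.factorial_pos k
  have hlb := Gamma_lb (D / 2) (by positivity) (l + k)
  rw [show (D / 2 + (l + k : ℕ) + 1 : ℝ) = (l + k : ℕ) + D / 2 + 1 by ring] at hlb
  simp only [EE, TT, if_pos (show l ≤ l + k by omega)]
  rw [norm_mul, norm_div, norm_div, norm_mul, norm_mul, norm_mul, norm_mul, norm_pow, norm_pow, norm_pow, norm_pow, norm_pow,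
    norm_Gamma]
  simp only [norm_neg, norm_one, one_pow, one_mul, Complex.norm_natCast, Complex.norm_ofNat]
  rw [show l + k - l = k by omega]
  set G := Real.Gamma ((l + k : ℕ) + D / 2 + 1) with hG
  have hGp : 0 < G := lt_of_lt_of_le (mul_pos hG0 (f0 _)) hlb
  have hc := Nat.choose_mul_factorial_mul_factorial (show k ≤ 2 * (l + k) + D by omega)
  rw [show 2 * (l + k) + D - k = l + k + l + D by omega] at hc
  have hc2 : (2 * (l + k) + D).choose k ≤ 2 ^ (2 * (l + k) + D) := Nat.choose_le_two_pow _ _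
  have hc3 : (((2 * (l + k) + D).choose k : ℕ) : ℝ) ≤ 2 ^ D * 4 ^ (l + k) := by
    have : (2 : ℝ) ^ D * 4 ^ (l + k) = ((2 ^ (2 * (l + k) + D) : ℕ) : ℝ) := by
      push_cast; rw [pow_add (2:ℝ) (2 * (l + k)) D, pow_mul]; norm_num; ring
    rw [this]
    exact_mod_cast hc2
  have e1 : ((2 * (l + k) + D).factorial : ℝ) / (2 ^ D * 4 ^ (l + k) * G ^ 2) * (1 / (k.factorial * (l + k + l + D).factorial))
     = (((2 * (l + k) + D).choose k : ℕ) : ℝ) / (2 ^ D * 4 ^ (l + k)) * (G ^ 2)⁻¹ := by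
    rw [← hc]
    push_cast
    have := (f0 k).ne'
    have := (f0 (l + k + l + D)).ne'
    field_simp
  rw [e1]
  have hfac : (l.factorial : ℝ) * k.factorial ≤ ((l + k).factorial : ℝ) ^ 2 := by
    have h1 : l.factorial ≤ (l + k).factorial := Nat.factorial_le (by omega)
    have h2 : k.factorial ≤ (l + k).factorial := Nat.factorial_le (by omega)
    rw [sq]
    exact_mod_cast Nat.mul_le_mul h1 h2
  calc _ ≤ 1 * (G ^ 2)⁻¹ := by
        gcongr
        rw [div_le_one (by positivity)]
        exact hc3
    _ ≤ ((Real.Gamma (D / 2 + 1) * (l + k).factorial) ^ 2)⁻¹ := by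
        rw [one_mul]
        have := mul_pos hG0 (f0 (l + k))
        gcongr
    _ = (Real.Gamma (D / 2 + 1) ^ 2)⁻¹ * (((l + k).factorial : ℝ) ^ 2)⁻¹ := by rw [mul_pow, mul_inv]
    _ ≤ (Real.Gamma (D / 2 + 1) ^ 2)⁻¹ * ((l.factorial : ℝ) * k.factorial)⁻¹ := by
        have := mul_pos (f0 l) (f0 k)
        gcongr
    _ = _ := by rw [mul_inv]

lemma moment_bound {d : ℕ} (f : EuclideanSpace ℝ (Fin d) → ℂ) (hf : Integrable f) (ρ : ℝ)
    (hsupp : ∀ᵐ x : EuclideanSpace ℝ (Fin d), ρ ≤ ‖x‖ → f x = 0) (n : ℕ) :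
    ‖∫ x, f x * (‖x‖ : ℂ) ^ (2 * n)‖ ≤ (∫ x, ‖f x‖) * (ρ ^ 2) ^ n := by
  rw [← integral_mul_const]
  refine norm_integral_le_of_norm_le (hf.norm.mul_const _) ?_
  filter_upwards [hsupp] with x hx
  by_cases h : ρ ≤ ‖x‖
  · simp [hx h]
  · push Not at h
    rw [norm_mul, norm_pow, Complex.norm_real, norm_norm, pow_mul]
    gcongr

lemma sigma_hasSum (D ℓ : ℕ) (κ : ℂ) (f : EuclideanSpace ℝ (Fin (D + 2)) → ℂ) (hf : Integrable f) (ρ : ℝ)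
    (hsupp : ∀ᵐ x : EuclideanSpace ℝ (Fin (D + 2)), ρ ≤ ‖x‖ → f x = 0) :
    HasSum (fun k : ℕ => EE D (ℓ + k) * TT D (ℓ + k) ℓ * κ ^ (ℓ + k) * ∫ x, f x * (‖x‖ : ℂ) ^ (2 * (ℓ + k)))
      (∫ x, f x * (phiF (D + 2) ℓ (κ ^ (1/2 : ℂ) * (‖x‖ : ℂ))) ^ 2) := by
  have hk : (κ ^ (1/2 : ℂ)) ^ 2 = κ := by
    have := Complex.cpow_nat_inv_pow κ (n := 2) two_ne_zero
    simpa using this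
  have hG0 : 0 < Real.Gamma (D / 2 + 1) := Real.Gamma_pos_of_pos (by positivity)
  set C : ℝ := (Real.Gamma (D / 2 + 1) ^ 2)⁻¹ with hC
  have h := hasSum_integral_of_dominated_convergence (μ := volume)
    (F := fun (k : ℕ) (x : EuclideanSpace ℝ (Fin (D + 2))) =>
      f x * (EE D (ℓ + k) * TT D (ℓ + k) ℓ * ((κ ^ (1/2 : ℂ) * (‖x‖ : ℂ)) ^ 2) ^ (ℓ + k)))
    (f := fun x => f x * (phiF (D + 2) ℓ (κ ^ (1/2 : ℂ) * (‖x‖ : ℂ))) ^ 2)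
    (fun k x => ‖f x‖ * (C * (ℓ.factorial : ℝ)⁻¹ * (‖κ‖ * ρ ^ 2) ^ ℓ * ((‖κ‖ * ρ ^ 2) ^ k / k.factorial))) ?_ ?_ ?_ ?_ ?_
  · convert! h using 2 with k
    rw [← integral_const_mul]
    congr 1
    funext x
    rw [mul_pow, hk, mul_pow, pow_mul]
    ring
  · intro m
    refine hf.aestronglyMeasurable.mul ?_
    apply Continuous.aestronglyMeasurable
    fun_prop
  · intro k
    filter_upwards [hsupp] with x hx
    by_cases h : ρ ≤ ‖x‖
    · simp [hx h]
    · push Not at h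
      rw [norm_mul, norm_mul (EE D (ℓ + k) * TT D (ℓ + k) ℓ), norm_pow, mul_pow, hk, norm_mul κ, norm_pow, Complex.norm_real, norm_norm]
      calc _ ≤ ‖f x‖ * (C * (((ℓ.factorial : ℝ))⁻¹ * ((k.factorial : ℝ))⁻¹) * (‖κ‖ * ρ ^ 2) ^ (ℓ + k)) := by
            gcongr
            exact ET_bound D ℓ k
        _ = _ := by rw [pow_add]; ring
  · exact Filter.Eventually.of_forall fun x => ((Real.summable_pow_div_factorial _).mul_left _).mul_left _
  · simp only [tsum_mul_left]
    exact hf.norm.mul_const _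
  · exact Filter.Eventually.of_forall fun x => (phiF_sq D ℓ _).mul_left _

lemma const_eq (D : ℕ) : (2 * (Real.pi : ℂ)) ^ (D + 2) / (sphereArea (D + 2) : ℂ) ^ 2
    = 2 ^ D * Complex.Gamma (D / 2 + 1) ^ 2 := by
  have hG0 : 0 < Real.Gamma (D / 2 + 1) := Real.Gamma_pos_of_pos (by positivity)
  have e : ((D + 2 : ℕ) : ℝ) / 2 = D / 2 + 1 := by push_cast; ring
  have hp : (Real.pi ^ (((D + 2 : ℕ) : ℝ) / 2)) ^ 2 = Real.pi ^ (D + 2) := by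
    rw [← Real.rpow_mul_natCast Real.pi_pos.le, ← Real.rpow_natCast]
    congr 1
    push_cast; ring
  have h1 : (sphereArea (D + 2)) ^ 2 = 4 * Real.pi ^ (D + 2) / Real.Gamma (D / 2 + 1) ^ 2 := by
    rw [sphereArea, div_pow, mul_pow, hp, e]; norm_num
  have h2 : (2 * Real.pi) ^ (D + 2) / (sphereArea (D + 2)) ^ 2 = 2 ^ D * Real.Gamma (D / 2 + 1) ^ 2 := by
    rw [h1, mul_pow, pow_add 2 D 2]
    have := Real.pi_pos
    field_simp
    norm_num
  have h3 : Complex.Gamma (D / 2 + 1) = ((Real.Gamma (D / 2 + 1) : ℝ) : ℂ) := by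
    rw [← Complex.Gamma_ofReal]; push_cast; rfl
  rw [h3]
  exact_mod_cast h2

lemma sphereArea_ne (D : ℕ) : (sphereArea (D + 2) : ℂ) ≠ 0 := by
  have : 0 < sphereArea (D + 2) := by
    unfold sphereArea
    have hG0 : 0 < Real.Gamma (((D + 2 : ℕ) : ℝ) / 2) := Real.Gamma_pos_of_pos (by positivity)
    have := Real.rpow_pos_of_pos Real.pi_pos (((D + 2 : ℕ) : ℝ) / 2)
    positivity
  exact_mod_cast this.ne'

lemma antidiag_hasSum {F : ℕ × ℕ → ℂ} {S : ℂ} (h : HasSum F S) :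
    HasSum (fun n => ∑ l ∈ Finset.range (n + 1), F (l, n - l)) S := by
  have h1 := (Finset.HasAntidiagonal.sigmaAntidiagonalEquivProd (A := ℕ)).hasSum_iff.mpr h
  have h2 := h1.sigma (fun n => hasSum_fintype _)
  convert! h2 using 1
  funext n
  rw [← Finset.Nat.sum_antidiagonal_eq_sum_range_succ_mk, ← Finset.sum_coe_sort]
  rfl

lemma col_alg (n D : ℕ) (κ x M G1 G2 N Y t T : ℂ) (hκ : κ ≠ 0) (g1 : G1 ≠ 0) (g2 : G2 ≠ 0) (hN : N ≠ 0)
    (ht : κ * t = x ^ 2 / 2)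
    (hT : G1⁻¹ * Y * T = 2 ^ n * t ^ n / (N * G2)) :
    κ ^ n * M * ((-1) ^ n * Y / (2 ^ D * 4 ^ n * G1 ^ 2) * T)
      = ((-1) ^ n * x ^ (2 * n) / (4 ^ n * N) * G2 / G1 * M) / (2 ^ D * G2 ^ 2) := by
  have e3 : κ ^ n * t ^ n = x ^ (2 * n) / 2 ^ n := by
    rw [← mul_pow, ht, pow_mul, ← div_pow]
  have e : κ ^ n * M * ((-1) ^ n * Y / (2 ^ D * 4 ^ n * G1 ^ 2) * T)
      = M * ((-1) ^ n / (2 ^ D * 4 ^ n * G1)) * (κ ^ n * (G1⁻¹ * Y * T)) := by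
    rw [div_eq_mul_inv, div_eq_mul_inv, mul_inv, mul_inv, mul_inv, sq, mul_inv]; ring
  have e' : κ ^ n * (2 ^ n * t ^ n / (N * G2)) = x ^ (2 * n) / (N * G2) := by
    have h2 : (2 : ℂ) ^ n ≠ 0 := pow_ne_zero _ two_ne_zero
    calc _ = 2 ^ n * (κ ^ n * t ^ n) / (N * G2) := by ring
      _ = _ := by rw [e3, mul_div_cancel₀ _ h2]
  rw [e, hT, e']
  generalize x ^ (2 * n) = X
  have h4 : (4 : ℂ) ^ n ≠ 0 := pow_ne_zero _ (by norm_num)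
  have h2 : (2 : ℂ) ^ D ≠ 0 := pow_ne_zero _ two_ne_zero
  generalize (4 : ℂ) ^ n = a at *
  generalize (2 : ℂ) ^ D = b at *
  generalize (-1 : ℂ) ^ n = c at *
  field_simp

lemma col_term (D n : ℕ) (κ : ℂ) (hκ : κ ≠ 0) (x M : ℂ) (Q : ℕ → ℂ) (hQ : QRec D (1 - x ^ 2 / (2 * κ)) Q) :
    κ ^ n * M * (EE D n * ∑ l ∈ Finset.range (n + 1), TT D n l * Q l)
      = ((-1) ^ n * x ^ (2 * n) / (4 ^ n * n.factorial) * Complex.Gamma (D / 2 + 1) /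
        Complex.Gamma (n + D / 2 + 1) * M) / (2 ^ D * Complex.Gamma (D / 2 + 1) ^ 2) := by
  have g1 : Complex.Gamma (n + D / 2 + 1) ≠ 0 := by
    have := Gne_of_re (re_mu D n) 0
    simpa using this
  have g0 : Complex.Gamma (D / 2 + 1) ≠ 0 := by
    have := Gne_of_re (re_mu D 0) 0
    simpa using this
  have f1 : (n.factorial : ℂ) ≠ 0 := by exact_mod_cast Nat.factorial_ne_zero n
  unfold EE
  refine col_alg n D κ x M _ _ _ _ (1 - (1 - x ^ 2 / (2 * κ))) _ hκ g1 g0 f1 ?_ (conn hQ n)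
  field_simp
  ring

lemma main_aux (D : ℕ) (κ : ℂ) (hκ : κ ≠ 0)
    (f : EuclideanSpace ℝ (Fin (D + 2)) → ℂ) (hf : Integrable f)
    (f₀ : ℝ → ℂ) (hrad : ∀ᵐ x : EuclideanSpace ℝ (Fin (D + 2)), f x = f₀ ‖x‖)
    (R : ℝ) (hsupp : ∀ᵐ x : EuclideanSpace ℝ (Fin (D + 2)), R ≤ ‖x‖ → f x = 0)
    (ξ : EuclideanSpace ℝ (Fin (D + 2))) (Q : ℕ → ℂ) (hQ : QRec D (1 - (‖ξ‖ : ℂ) ^ 2 / (2 * κ)) Q) :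
    HasSum (fun ℓ : ℕ => (∫ x, f x * (phiF (D + 2) ℓ (κ ^ (1/2 : ℂ) * (‖x‖ : ℂ))) ^ 2) * Q ℓ)
      ((∫ x : EuclideanSpace ℝ (Fin (D + 2)), f x * Complex.exp (-Complex.I * (⟪ξ, x⟫ : ℝ))) /
        (2 ^ D * Complex.Gamma (D / 2 + 1) ^ 2)) := by
  set s : ℂ := 1 - (‖ξ‖ : ℂ) ^ 2 / (2 * κ) with hs
  obtain ⟨F, hF⟩ : ∃ F : ℕ × ℕ → ℂ, ∀ p, F p = EE D (p.1 + p.2) * TT D (p.1 + p.2) p.1 * κ ^ (p.1 + p.2) *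
    (∫ x, f x * (‖x‖ : ℂ) ^ (2 * (p.1 + p.2))) * Q p.1 := ⟨_, fun _ => rfl⟩
  have hG0 : 0 < Real.Gamma (D / 2 + 1) := Real.Gamma_pos_of_pos (by positivity)
  obtain ⟨C, hC⟩ : ∃ C : ℝ, C = (Real.Gamma (D / 2 + 1) ^ 2)⁻¹ := ⟨_, rfl⟩
  have hC0 : 0 ≤ C := by rw [hC]; positivity
  obtain ⟨A, hA⟩ : ∃ A : ℝ, A = ∫ x, ‖f x‖ := ⟨_, rfl⟩
  have hA0 : 0 ≤ A := by rw [hA]; exact integral_nonneg fun x => norm_nonneg _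
  obtain ⟨w, hw⟩ : ∃ w : ℝ, w = ‖κ‖ * R ^ 2 := ⟨_, rfl⟩
  have hw0 : 0 ≤ w := by rw [hw]; positivity
  obtain ⟨B, hB⟩ : ∃ B : ℝ, B = (D + 2) * (‖s‖ + 1) := ⟨_, rfl⟩
  have hB0 : 0 ≤ B := by rw [hB]; positivity
  have hFb : ∀ p, ‖F p‖ ≤ (C * A) * (((B * w) ^ p.1 / p.1.factorial) * (w ^ p.2 / p.2.factorial)) := by
    intro p
    have b1 := ET_bound D p.1 p.2
    have b2 := moment_bound f hf R hsupp (p.1 + p.2)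
    have b3 := hQ.bound p.1
    rw [← hB] at b3
    rw [← hC] at b1
    rw [← hA] at b2
    rw [hF, norm_mul, norm_mul, norm_mul _ (κ ^ _), norm_pow]
    calc _ ≤ (C * (((p.1.factorial : ℝ))⁻¹ * ((p.2.factorial : ℝ))⁻¹)) * ‖κ‖ ^ (p.1 + p.2) * (A * (R ^ 2) ^ (p.1 + p.2)) * B ^ p.1 := by
          gcongr
      _ = _ := by rw [hw]; ring
  have hFs : Summable F := by
    refine Summable.of_norm_bounded (Summable.mul_left _ ?_) hFb
    exact Summable.mul_of_nonneg (Real.summable_pow_div_factorial _) (Real.summable_pow_div_factorial _)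
      (fun n => by positivity) (fun n => by positivity)
  obtain ⟨S, hS⟩ := hFs
  have row := hS.prod_fiberwise (fun ℓ => by
    have := (sigma_hasSum D ℓ κ f hf R hsupp).mul_right (Q ℓ)
    simpa only [hF] using this)
  have col := antidiag_hasSum hS
  have four := fourier_side (d := D + 2) (by omega) f hf f₀ hrad R hsupp ξ
  have hS2 : S = (∫ x : EuclideanSpace ℝ (Fin (D + 2)), f x * Complex.exp (-Complex.I * (⟪ξ, x⟫ : ℝ))) /
        (2 ^ D * Complex.Gamma (D / 2 + 1) ^ 2) := by
    refine col.unique ?_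
    convert! four.div_const (2 ^ D * Complex.Gamma (D / 2 + 1) ^ 2) using 1
    funext n
    have e1 : ∑ l ∈ Finset.range (n + 1), F (l, n - l) = κ ^ n * (∫ x, f x * (‖x‖ : ℂ) ^ (2 * n)) *
        (EE D n * ∑ l ∈ Finset.range (n + 1), TT D n l * Q l) := by
      rw [Finset.mul_sum, Finset.mul_sum]
      refine Finset.sum_congr rfl fun l hl => ?_
      have : l + (n - l) = n := by simp at hl; omega
      rw [hF]
      simp only [this]
      ring
    have e4 : (n : ℂ) + ((D + 2 : ℕ) : ℂ) / 2 = n + D / 2 + 1 := by push_cast; ring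
    have e5 : ((D + 2 : ℕ) : ℂ) / 2 = D / 2 + 1 := by push_cast; ring
    rw [e1, e4, e5]
    exact col_term D n κ hκ _ _ Q hQ
  rw [← hS2]
  exact row

end FRR
/-- Fourier representation of a compactly supported radial `L¹` function in
terms of its κ-moments and the zonal functions. -/
theorem fourier_repr_radial (d : ℕ) (hd : 2 ≤ d) (κ : ℂ) (hκ : κ ≠ 0)
    (f : EuclideanSpace ℝ (Fin d) → ℂ) (hf : Integrable f)
    (f₀ : ℝ → ℂ) (hrad : ∀ᵐ x : EuclideanSpace ℝ (Fin d), f x = f₀ ‖x‖)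
    (R : ℝ) (hsupp : ∀ᵐ x : EuclideanSpace ℝ (Fin d), R ≤ ‖x‖ → f x = 0)
    (P : ℕ → Polynomial ℂ) (hP : ∀ ℓ : ℕ, IsLegendre d ℓ (P ℓ))
    (ξ : EuclideanSpace ℝ (Fin d)) :
    Summable (fun ℓ : ℕ =>
      ‖kappaMoment d ℓ κ f * zonal d ℓ (P ℓ) (1 - (‖ξ‖ : ℂ) ^ 2 / (2 * κ))‖) ∧
    (∫ x : EuclideanSpace ℝ (Fin d), f x * Complex.exp (-Complex.I * (⟪ξ, x⟫ : ℝ))) =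
      (2 * (Real.pi : ℂ)) ^ d *
        ∑' ℓ : ℕ, kappaMoment d ℓ κ f * zonal d ℓ (P ℓ) (1 - (‖ξ‖ : ℂ) ^ 2 / (2 * κ)) := by
  obtain ⟨D, rfl⟩ : ∃ D, d = D + 2 := ⟨d - 2, by omega⟩
  have hQ := FRR.QRec_of D P hP (1 - (‖ξ‖ : ℂ) ^ 2 / (2 * κ))
  have h := (FRR.main_aux D κ hκ f hf f₀ hrad R hsupp ξ _ hQ).mul_left
    (1 / (sphereArea (D + 2) : ℂ) ^ 2)
  have hS := FRR.sphereArea_ne D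
  have hc := FRR.const_eq D
  have h' : HasSum (fun ℓ : ℕ =>
      kappaMoment (D + 2) ℓ κ f * zonal (D + 2) ℓ (P ℓ) (1 - (‖ξ‖ : ℂ) ^ 2 / (2 * κ)))
      (1 / (sphereArea (D + 2) : ℂ) ^ 2 *
      ((∫ x : EuclideanSpace ℝ (Fin (D + 2)), f x * Complex.exp (-Complex.I * (⟪ξ, x⟫ : ℝ))) /
        (2 ^ D * Complex.Gamma (D / 2 + 1) ^ 2))) := by
    convert! h using 1
    funext ℓ
    unfold kappaMoment zonal
    ring
  refine ⟨h'.summable.norm, ?_⟩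
  rw [h'.tsum_eq, ← hc]
  have hpi : (Real.pi : ℂ) ≠ 0 := by exact_mod_cast Real.pi_ne_zero
  have hp : (2 * (Real.pi : ℂ)) ^ (D + 2) ≠ 0 := pow_ne_zero _ (mul_ne_zero two_ne_zero hpi)
  generalize (2 * (Real.pi : ℂ)) ^ (D + 2) = A at *
  generalize (sphereArea (D + 2) : ℂ) = B at *
  field_simp
end

section
/- Let d ≥ 2 be an integer, ℓ ∈ ℕ₀, κ ∈ ℂ \ {0}, r > 0, and let ζ₁, ζ₂ ∈ ℂ^d satisfy ζ₁·ζ₁ = ζ₂·ζ₂ = −κ (bilinear dot product). Then ∫_{S^{d−1}} (𝒫_ℓ e_{rζ₁})(x) · (𝒫_ℓ e_{rζ₂})(x) dσ(x) = (2π)^d φ_ℓ(√κ r)² · Z_{ℓ,d}((ζ₁·ζ₂)/κ). -/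
open MeasureTheory

noncomputable section

/-- The surface measure on the unit sphere of `ℝ^d`. -/
def sphMeasure (d : ℕ) :
    Measure (Metric.sphere (0 : EuclideanSpace ℝ (Fin d)) 1) :=
  (volume : Measure (EuclideanSpace ℝ (Fin d))).toSphere

open scoped RealInnerProductSpace in
/-- The projector `𝒫_ℓ` onto spherical harmonics of degree ℓ, expressed through the Legendre
polynomial `P` (to be taken equal to `P_{ℓ,d}`). -/
def projector (d ℓ : ℕ) (P : Polynomial ℂ)
    (f : Metric.sphere (0 : EuclideanSpace ℝ (Fin d)) 1 → ℂ)
    (x : Metric.sphere (0 : EuclideanSpace ℝ (Fin d)) 1) : ℂ :=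
  ((Nld d ℓ : ℂ) / (sphereArea d : ℂ)) *
    ∫ y, ((P.eval ((⟪(x : EuclideanSpace ℝ (Fin d)), (y : EuclideanSpace ℝ (Fin d))⟫ : ℝ) : ℂ)) *
      f y) ∂ sphMeasure d

/-- The exponential function `e_ζ(x) = exp(ζ · x)` restricted to the unit sphere. -/
def expFun (d : ℕ) (ζ : Fin d → ℂ)
    (y : Metric.sphere (0 : EuclideanSpace ℝ (Fin d)) 1) : ℂ :=
  Complex.exp (∑ i, ζ i * ((y : EuclideanSpace ℝ (Fin d)) i : ℂ))

end

noncomputable section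

section Leg
open Polynomial

def legQ (β : ℝ) : ℕ → ℝ[X]
  | 0 => 1
  | k+1 => (1 - X^2) * derivative (legQ β k) - C (2*(β-k)) * X * legQ β k

lemma legQ_deriv (β : ℝ) (k : ℕ) :
    derivative (legQ β (k+1)) = - C ((k+1)*(2*β-k)) * legQ β k := by
  induction k with
  | zero => simp [legQ]
  | succ k ih =>
    have h1 : legQ β (k+1) = (1 - X^2) * derivative (legQ β k) - C (2*(β-k)) * X * legQ β k := rfl
    have h2 : legQ β (k+1+1) = (1 - X^2) * derivative (legQ β (k+1))
      - C (2*(β-(k+1:ℕ))) * X * legQ β (k+1) := rfl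
    have hd : derivative (legQ β (k+1+1)) = (1 - X^2) * derivative (derivative (legQ β (k+1)))
      - C 2 * X * derivative (legQ β (k+1)) - C (2*(β-(k+1:ℕ))) * legQ β (k+1)
      - C (2*(β-(k+1:ℕ))) * X * derivative (legQ β (k+1)) := by
      rw [h2]
      simp only [derivative_sub, derivative_mul, derivative_one, derivative_X_pow, derivative_C,
        derivative_X]
      push_cast
      simp
      ring
    have hdd : derivative (derivative (legQ β (k+1))) =
      - C ((k+1)*(2*β-k)) * derivative (legQ β k) := by
      rw [ih]; simp
    have hw : (1 - X^2) * derivative (legQ β k) = legQ β (k+1) + C (2*(β-k)) * X * legQ β k := by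
      rw [h1]; ring
    rw [hd, hdd]
    have : (1 - X^2) * (- C ((k+1)*(2*β-k)) * derivative (legQ β k)) =
      - C ((k+1)*(2*β-k)) * (legQ β (k+1) + C (2*(β-k)) * X * legQ β k) := by
      rw [← hw]; ring
    rw [this, ih]
    simp only [map_mul, map_add, map_sub, map_ofNat, map_one, map_natCast]
    push_cast
    ring

lemma legQ_ode (β : ℝ) (k : ℕ) :
    (1 - X^2) * derivative (derivative (legQ β k)) =
      C (2*(β-k+1)) * X * derivative (legQ β k) - C (k*(2*β-k+1)) * legQ β k := by
  cases k with
  | zero => simp [legQ]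
  | succ k =>
    have ih := legQ_deriv β k
    have h1 : legQ β (k+1) = (1 - X^2) * derivative (legQ β k) - C (2*(β-k)) * X * legQ β k := rfl
    have hdd : derivative (derivative (legQ β (k+1))) =
      - C ((k+1)*(2*β-k)) * derivative (legQ β k) := by
      rw [ih]; simp
    have hw : (1 - X^2) * derivative (legQ β k) = legQ β (k+1) + C (2*(β-k)) * X * legQ β k := by
      rw [h1]; ring
    rw [hdd]
    have : (1 - X^2) * (- C ((k+1)*(2*β-k)) * derivative (legQ β k)) =
      - C ((k+1)*(2*β-k)) * (legQ β (k+1) + C (2*(β-k)) * X * legQ β k) := by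
      rw [← hw]; ring
    rw [this, ih]
    simp only [map_mul, map_add, map_sub, map_ofNat, map_one, map_natCast]
    push_cast
    ring

lemma legQ_natDegree (β : ℝ) (k : ℕ) : (legQ β k).natDegree ≤ k := by
  induction k with
  | zero => simp [legQ]
  | succ k ih =>
    have hd : (derivative (legQ β k)).natDegree ≤ k - 1 := (natDegree_derivative_le _).trans (by omega)
    have h3 : ((1 - X^2) * derivative (legQ β k)).natDegree ≤ k + 1 := by
      rcases Nat.eq_zero_or_pos k with h0 | h0
      · subst h0; simp [legQ]
      · refine natDegree_mul_le.trans ?_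
        have : (1 - X^2 : ℝ[X]).natDegree ≤ 2 := by compute_degree
        omega
    refine (natDegree_sub_le _ _).trans (max_le h3 ?_)
    refine natDegree_mul_le.trans ?_
    have : (C (2*(β-k)) * X : ℝ[X]).natDegree ≤ 1 := by compute_degree
    omega

lemma legQ_coeff (β : ℝ) (k : ℕ) :
    (legQ β k).coeff k = (-1)^k * ∏ j ∈ Finset.range k, (2*β - j) := by
  induction k with
  | zero => simp [legQ]
  | succ k ih =>
    rw [Finset.prod_range_succ, pow_succ]
    have h1 : (legQ β (k+1)).coeff (k+1) = -(2*β-k) * (legQ β k).coeff k := by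
      have : legQ β (k+1) = derivative (legQ β k) - X * (X* derivative (legQ β k)) - C (2*(β-k)) * (X * legQ β k) := by
        rw [legQ]; ring
      rw [this]
      have e1 : (derivative (legQ β k)).coeff (k+1) = 0 := by
        apply coeff_eq_zero_of_natDegree_lt
        have := natDegree_derivative_le (legQ β k)
        have := legQ_natDegree β k
        omega
      have e2 : (X * derivative (legQ β k)).coeff k = k * (legQ β k).coeff k := by
        cases k with
        | zero => simp
        | succ k => rw [coeff_X_mul, coeff_derivative]; push_cast; ring
      rw [coeff_sub, coeff_sub, coeff_C_mul, coeff_X_mul, coeff_X_mul, e1, e2]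
      ring
    rw [h1, ih]; ring

lemma iteratedDeriv_legQ (β : ℝ) (k : ℕ) : ∀ t ∈ Set.Ioo (-1:ℝ) 1,
    iteratedDeriv k (fun s : ℝ => (1 - s ^ 2) ^ β) t = (1 - t^2)^(β - k) * (legQ β k).eval t := by
  induction k with
  | zero => intro t ht; simp [legQ]
  | succ k ih =>
    intro t ht
    have hpos : 0 < 1 - t^2 := by nlinarith [ht.1, ht.2]
    rw [iteratedDeriv_succ]
    have hev : iteratedDeriv k (fun s : ℝ => (1 - s ^ 2) ^ β) =ᶠ[nhds t]
      fun t => (1 - t^2)^(β - k) * (legQ β k).eval t := by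
      filter_upwards [Ioo_mem_nhds ht.1 ht.2] with s hs using ih s hs
    rw [hev.deriv_eq]
    have hw : HasDerivAt (fun t : ℝ => 1 - t^2) (-(2*t)) t := by
      simpa using ((hasDerivAt_pow 2 t).const_sub 1)
    have := (hw.rpow_const (p := β - k) (Or.inl hpos.ne')).mul ((legQ β k).hasDerivAt t)
    refine this.deriv.trans ?_
    have e : (1 - t^2)^(β-k) = (1-t^2)^(β - (k+1:ℕ)) * (1 - t^2) := by
      rw [← Real.rpow_add_one hpos.ne']; congr 1; push_cast; ring
    have e' : (1 - t^2)^(β-k-1) = (1-t^2)^(β - (k+1:ℕ)) := by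
      congr 1; push_cast; ring
    rw [e', e, legQ]
    simp
    ring

def legR (d ℓ : ℕ) : ℝ := Real.Gamma (((d : ℝ) - 1) / 2) /
      (2 ^ ℓ * Real.Gamma ((ℓ : ℝ) + ((d : ℝ) - 1) / 2))

lemma isLegendre_eq {d ℓ : ℕ} {P : ℂ[X]} (hP : IsLegendre d ℓ P) :
    P = ((C ((-1)^ℓ * legR d ℓ) * legQ ((ℓ:ℝ) + ((d:ℝ)-3)/2) ℓ).map Complex.ofRealHom) := by
  apply Polynomial.eq_of_infinite_eval_eq
  refine Set.Infinite.mono (s := (fun t : ℝ => (t:ℂ)) '' Set.Ioo (-1:ℝ) 1) ?_ ?_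
  · rintro _ ⟨t, ht, rfl⟩
    have hpos : 0 < 1 - t^2 := by nlinarith [ht.1, ht.2]
    simp only [Set.mem_ofPred_eq]
    rw [hP.2 t ht, legendreRHS, iteratedDeriv_legQ _ _ t ht]
    have := Polynomial.eval_map_apply (f := Complex.ofRealHom) (p := C ((-1)^ℓ * legR d ℓ) * legQ ((ℓ:ℝ) + ((d:ℝ)-3)/2) ℓ) t
    rw [show ((t:ℝ):ℂ) = Complex.ofRealHom t from rfl, this]
    simp only [Complex.ofRealHom_eq_coe]
    refine congrArg _ ?_
    have e : (1 - t^2)^(-(((d:ℝ)-3)/2)) * (1-t^2)^((ℓ:ℝ) + ((d:ℝ)-3)/2 - ℓ) = 1 := by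
      rw [← Real.rpow_add hpos]; ring_nf; simp
    simp only [eval_mul, eval_C, legR]
    linear_combination ((-1)^ℓ * (Real.Gamma (((d : ℝ) - 1) / 2) /
      (2 ^ ℓ * Real.Gamma ((ℓ : ℝ) + ((d : ℝ) - 1) / 2))) *
        eval t (legQ ((ℓ:ℝ) + ((d:ℝ)-3)/2) ℓ)) * e
  · exact (Set.Ioo_infinite (by norm_num)).image (Complex.ofReal_injective.injOn)

lemma isLegendre_ode {d ℓ : ℕ} {P : ℂ[X]} (hP : IsLegendre d ℓ P) :
    (1 - X^2) * derivative (derivative P) =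
      C ((d:ℂ)-1) * X * derivative P - C ((ℓ:ℂ)*(ℓ+d-2)) * P := by
  have h := congrArg (Polynomial.map Complex.ofRealHom)
    (congrArg (fun q => C ((-1)^ℓ * legR d ℓ) * q) (legQ_ode ((ℓ:ℝ) + ((d:ℝ)-3)/2) ℓ))
  have e1 : (2*((ℓ:ℝ) + ((d:ℝ)-3)/2 - ℓ + 1)) = d - 1 := by ring
  have e2 : ((ℓ:ℝ)*(2*((ℓ:ℝ) + ((d:ℝ)-3)/2) - ℓ + 1)) = ℓ * (ℓ + d - 2) := by ring
  rw [e1, e2] at h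
  have hP' := isLegendre_eq hP
  rw [Polynomial.map_mul] at hP'
  rw [hP']
  simp only [derivative_mul, Polynomial.map_mul, Polynomial.map_sub, map_C, Polynomial.map_X,
    Polynomial.map_pow, Polynomial.map_one, derivative_map, derivative_C,
    zero_mul, zero_add] at h ⊢
  simp only [map_mul, map_sub, map_add, map_natCast, map_one, map_ofNat] at h ⊢
  linear_combination h

lemma isLegendre_rec {d ℓ : ℕ} {P : ℂ[X]} (hP : IsLegendre d ℓ P) (m : ℕ) :
    ((m:ℂ)+2)*(m+1) * P.coeff (m+2) + ((ℓ:ℂ)-m)*(ℓ+m+d-2) * P.coeff m = 0 := by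
  have h : derivative (derivative P) - X * (X * derivative (derivative P)) =
      C ((d:ℂ)-1) * (X * derivative P) - C ((ℓ:ℂ)*(ℓ+d-2)) * P := by
    have := isLegendre_ode hP
    linear_combination this
  have e1 : ∀ Q : ℂ[X], (X * derivative Q).coeff m = m * Q.coeff m := by
    intro Q
    cases m with
    | zero => simp
    | succ k => rw [coeff_X_mul, coeff_derivative]; push_cast; ring
  have e2 : (X * (X * derivative (derivative P))).coeff m = m * (m-1) * P.coeff m := by
    cases m with
    | zero => simp
    | succ k =>
      rw [coeff_X_mul]
      cases k with
      | zero => simp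
      | succ k => rw [coeff_X_mul, coeff_derivative, coeff_derivative]; push_cast; ring
  have h' := congrArg (fun Q => Q.coeff m) h
  simp only [coeff_sub, coeff_C_mul, e1, e2, coeff_derivative] at h'
  push_cast at h'
  linear_combination h'

lemma isLegendre_lead {d ℓ : ℕ} {P : ℂ[X]} (hP : IsLegendre d ℓ P) :
    P.coeff ℓ = ((legR d ℓ * ∏ j ∈ Finset.range ℓ, (2*(ℓ:ℝ) + d - 3 - j) : ℝ) : ℂ) := by
  rw [isLegendre_eq hP, coeff_map, coeff_C_mul, legQ_coeff, Complex.ofRealHom_eq_coe]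
  congr 1
  have : ∀ j : ℕ, (2 * ((ℓ:ℝ) + ((d:ℝ)-3)/2) - j) = 2*(ℓ:ℝ) + d - 3 - j := by intro j; ring
  simp only [this]
  have h2 : ((-1:ℝ)^ℓ) * (-1)^ℓ = 1 := by rw [← mul_pow]; simp
  linear_combination (legR d ℓ * ∏ j ∈ Finset.range ℓ, (2*(ℓ:ℝ) + d - 3 - j)) * h2

lemma isLegendre_odd {d ℓ : ℕ} (hd : 2 ≤ d) {P : ℂ[X]} (hP : IsLegendre d ℓ P) (k : ℕ) :
    ∀ m, m + (2*k+1) = ℓ → P.coeff m = 0 := by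
  have key : ∀ m, m < ℓ → P.coeff (m+2) = 0 → P.coeff m = 0 := by
    intro m hm h0
    have := isLegendre_rec hP m
    rw [h0, mul_zero, zero_add] at this
    have h1 : (ℓ:ℂ) - m ≠ 0 := by
      rw [sub_ne_zero]; exact_mod_cast hm.ne'
    have h2 : (ℓ:ℂ)+m+d-2 ≠ 0 := by
      rw [sub_ne_zero]
      have : ℓ + m + d ≠ 2 := by omega
      exact_mod_cast this
    simpa [h1, h2] using this
  induction k with
  | zero =>
    intro m hm
    apply key m (by omega)
    apply coeff_eq_zero_of_natDegree_lt
    rw [hP.1]; omega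
  | succ k ih =>
    intro m hm
    exact key m (by omega) (ih (m+2) (by omega))

lemma isLegendre_eval {d ℓ : ℕ} (hd : 2 ≤ d) {P : ℂ[X]} (hP : IsLegendre d ℓ P) (s : ℂ) :
    P.eval s = ∑ j ∈ Finset.range (ℓ/2+1), P.coeff (ℓ-2*j) * s^(ℓ-2*j) := by
  rw [eval_eq_sum_range, hP.1, ← Finset.sum_range_reflect]
  symm
  refine Finset.sum_of_injOn (fun j => 2*j) ?_ ?_ ?_ ?_
  · intro a _ b _ h; simpa using h
  · intro a ha; simp at ha ⊢; omega
  · intro i hi hn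
    simp at hi hn
    have : i % 2 = 1 := by
      by_contra hc
      exact hn (i/2) (by omega) (by omega)
    rw [isLegendre_odd hd hP (i/2) (ℓ+1-1-i) (by omega), zero_mul]
  · intro i hi; simp

lemma Nld_fact (d ℓ : ℕ) (hd : 2 ≤ d) :
    (Nld d ℓ : ℝ) * ℓ.factorial * (∏ j ∈ Finset.range ℓ, (2*(ℓ:ℝ) + d - 3 - j)) * (d-2).factorial =
      (2*ℓ+d-2).factorial := by
  obtain ⟨e, rfl⟩ : ∃ e, d = e + 2 := ⟨d-2, by omega⟩
  cases ℓ with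
  | zero => simp [Nld]
  | succ n =>
    have hprod : (∏ j ∈ Finset.range (n+1), (2*((n+1:ℕ):ℝ) + (e+2:ℕ) - 3 - j)) * (n+e).factorial
        = (2*n+e+1).factorial := by
      have h1 : ∀ j ∈ Finset.range (n+1), (2*((n+1:ℕ):ℝ) + (e+2:ℕ) - 3 - j) = ((2*n+e+1 - j : ℕ):ℝ) := by
        intro j hj
        simp at hj
        rw [Nat.cast_sub (by omega)]; push_cast; ring
      rw [Finset.prod_congr rfl h1, ← Nat.cast_prod, ← Nat.descFactorial_eq_prod_range]
      have := Nat.factorial_mul_descFactorial (n := 2*n+e+1) (k := n+1) (by omega)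
      rw [show 2*n+e+1-(n+1) = n+e by omega] at this
      rw [mul_comm]
      exact_mod_cast this
    have hN : (Nld (e+2) (n+1) : ℝ) * (n+1).factorial * e.factorial = (2*n+e+2) * (n+e).factorial := by
      have h1 : ((n+e+2).choose (n+1) : ℝ) * ((n+1).factorial) * (e+1).factorial = (n+e+2).factorial := by
        have := Nat.add_choose_mul_factorial_mul_factorial (n+1) (e+1)
        rw [show n+1+(e+1) = n+e+2 by omega] at this
        rw [← this, Nat.choose_symm_of_eq_add (show n+e+2 = n+1+(e+1) by omega)]; push_cast; ring
      have hN' : (Nld (e+2) (n+1) : ℝ) = ((n+e+2).choose (n+1) : ℝ) - (if 2 ≤ n+1 then (n+e).choose (n-1) else 0 : ℕ) := by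
        rw [Nld, show n+1+(e+2)-1 = n+e+2 by omega, show n+1+(e+2)-3 = n+e by omega,
          show n+1-2 = n-1 by omega, Nat.cast_sub]
        split_ifs with h
        · calc (n+e).choose (n-1) ≤ (n+e+1).choose n := by
                obtain ⟨k, rfl⟩ : ∃ k, n = k+1 := ⟨n-1, by omega⟩
                rw [Nat.choose_succ_succ]; simp
            _ ≤ (n+e+2).choose (n+1) := by
                rw [Nat.choose_succ_succ (n+e+1)]; simp
        · simp
      have f1 : ((e+1).factorial : ℝ) = (e+1) * e.factorial := by
        rw [Nat.factorial_succ]; push_cast; ring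
      have f2 : ((n+e+2).factorial : ℝ) = (n+e+2) * (n+e+1) * (n+e).factorial := by
        rw [Nat.factorial_succ, Nat.factorial_succ]; push_cast; ring
      have hpos : ((e:ℝ)+1) ≠ 0 := by positivity
      apply mul_left_cancel₀ hpos
      rw [hN']
      rcases Nat.eq_zero_or_pos n with h0 | h0
      · subst h0
        simp at h1 f1 f2 ⊢
      · obtain ⟨k, rfl⟩ : ∃ k, n = k+1 := ⟨n-1, by omega⟩
        have h2 : ((k+1+e).choose k : ℝ) * k.factorial * (e+1).factorial = (k+1+e).factorial := by
          have := Nat.add_choose_mul_factorial_mul_factorial k (e+1)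
          rw [show k+(e+1) = k+1+e by omega] at this
          rw [← this, Nat.choose_symm_of_eq_add (show k+1+e = k+(e+1) by omega)]; push_cast; ring
        have f3 : ((k+1+1).factorial : ℝ) = (k+2) * (k+1) * k.factorial := by
          rw [Nat.factorial_succ, Nat.factorial_succ]; push_cast; ring
        simp only [show 2 ≤ k+1+1 by omega, if_true, Nat.add_sub_cancel]
        rw [f2, f3, f1] at h1
        rw [f1] at h2
        rw [f3]
        push_cast at h1 h2 ⊢
        linear_combination h1 - (k+2)*(k+1)*h2
    have f4 : ((2*(n+1)+(e+2)-2).factorial : ℝ) = (2*n+e+2) * (2*n+e+1).factorial := by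
      rw [show 2*(n+1)+(e+2)-2 = 2*n+e+1+1 by omega, Nat.factorial_succ]; push_cast; ring
    rw [f4, Nat.add_sub_cancel, ← hprod]
    linear_combination (∏ j ∈ Finset.range (n+1), (2*((n+1:ℕ):ℝ) + (e+2:ℕ) - 3 - j)) * hN

lemma const_identity (d ℓ : ℕ) (hd : 2 ≤ d) :
    (Nld d ℓ : ℝ) * (legR d ℓ * ∏ j ∈ Finset.range ℓ, (2*(ℓ:ℝ) + d - 3 - j)) * ℓ.factorial *
      (2*Real.pi)^((d:ℝ)/2) =
    sphereArea d * ((2:ℝ)^((ℓ:ℝ) + (d:ℝ)/2 - 1) * Real.Gamma (ℓ + (d:ℝ)/2)) := by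
  have hN := Nld_fact d ℓ hd
  have hd' : (2:ℝ) ≤ d := by exact_mod_cast hd
  have D1 := Real.Gamma_mul_Gamma_add_half (((d:ℝ)-1)/2)
  have D2 := Real.Gamma_mul_Gamma_add_half ((ℓ:ℝ) + ((d:ℝ)-1)/2)
  rw [show ((d:ℝ)-1)/2 + 1/2 = d/2 by ring, show 2*(((d:ℝ)-1)/2) = (d-2:ℕ) + 1 by
    push_cast [Nat.cast_sub hd]; ring, Real.Gamma_nat_eq_factorial] at D1
  rw [show (ℓ:ℝ)+((d:ℝ)-1)/2 + 1/2 = ℓ + d/2 by ring, show 2*((ℓ:ℝ)+((d:ℝ)-1)/2) = (2*ℓ+d-2:ℕ) + 1 by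
    rw [Nat.cast_sub (by omega)]; push_cast; ring, Real.Gamma_nat_eq_factorial] at D2
  have g1 : Real.Gamma ((ℓ:ℝ)+((d:ℝ)-1)/2) ≠ 0 := (Real.Gamma_pos_of_pos (by
    have : (0:ℝ) ≤ ℓ := by positivity
    linarith)).ne'
  have g2 : Real.Gamma ((d:ℝ)/2) ≠ 0 := (Real.Gamma_pos_of_pos (by linarith)).ne'
  have p1 : (2*Real.pi)^((d:ℝ)/2) = 2^((d:ℝ)/2) * Real.pi^((d:ℝ)/2) :=
    Real.mul_rpow (by norm_num) Real.pi_pos.le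
  have p2 : (2:ℝ)^((ℓ:ℝ) + (d:ℝ)/2 - 1) = 2^ℓ * 2^((d:ℝ)/2) / 2 := by
    rw [Real.rpow_sub_one (by norm_num), Real.rpow_add (by norm_num), Real.rpow_natCast]
  have p3 : (2:ℝ)^(1 - ((d-2:ℕ) + 1 : ℝ)) = 2^ℓ * 2^ℓ * (2:ℝ)^(1 - ((2*ℓ+d-2:ℕ) + 1 : ℝ)) := by
    rw [← pow_add, ← Real.rpow_natCast, ← Real.rpow_add (by norm_num)]
    congr 1
    rw [Nat.cast_sub (by omega), Nat.cast_sub (by omega)]; push_cast; ring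
  rw [p3] at D1
  rw [p1, p2, legR, sphereArea]
  generalize Real.Gamma ((ℓ:ℝ)+((d:ℝ)-1)/2) = G1 at *
  generalize Real.Gamma ((ℓ:ℝ)+(d:ℝ)/2) = G2 at *
  generalize Real.Gamma (((d:ℝ)-1)/2) = G3 at *
  generalize Real.Gamma ((d:ℝ)/2) = G4 at *
  field_simp
  have hf : ((d-2).factorial:ℝ) ≠ 0 := by positivity
  apply mul_left_cancel₀ hf
  linear_combination (G3 * G4) * hN + ((2*ℓ+d-2).factorial:ℝ) * D1 - ((d-2).factorial:ℝ) * 2^ℓ * 2^ℓ * D2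

end Leg

end

noncomputable section
section Gauss
open MvPolynomial

def gm (n : ℕ) : ℝ := ∫ x : ℝ, x^n * Real.exp (-x^2/2)

lemma gm_integrable (n : ℕ) : Integrable (fun x : ℝ => x^n * Real.exp (-x^2/2)) := by
  have := integrable_rpow_mul_exp_neg_mul_sq (b := 1/2) (by norm_num) (s := n) (by
    have : (0:ℝ) ≤ n := by positivity
    linarith)
  refine this.congr (Filter.Eventually.of_forall fun x => ?_)
  simp only [Real.rpow_natCast]
  congr 2; ring

lemma gm_succ (n : ℕ) : gm (n+2) = (n+1) * gm n := by
  have h := integral_mul_deriv_eq_deriv_mul_of_integrable (u := fun x : ℝ => x^(n+1))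
    (u' := fun x => (n+1)*x^n) (v := fun x => -Real.exp (-x^2/2)) (v' := fun x => x * Real.exp (-x^2/2))
    (fun x _ => by simpa using hasDerivAt_pow (n+1) x)
    (fun x _ => by
      have h1 : HasDerivAt (fun x : ℝ => -x^2/2) (-x) x := by
        have := ((hasDerivAt_pow 2 x).neg.div_const 2)
        convert! this using 1; simp; ring
      convert! h1.exp.neg using 1; ring)
    (by
      refine (gm_integrable (n+2)).congr (Filter.Eventually.of_forall fun x => ?_)
      simp; ring)
    (by
      refine ((gm_integrable n).const_mul (-(n+1:ℝ))).congr (Filter.Eventually.of_forall fun x => ?_)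
      simp; ring)
    (by
      refine ((gm_integrable (n+1)).neg).congr (Filter.Eventually.of_forall fun x => ?_)
      simp)
  rw [gm, gm, ← integral_const_mul]
  have e1 : (∫ x : ℝ, x^(n+2) * Real.exp (-x^2/2)) = ∫ x : ℝ, x^(n+1) * (x * Real.exp (-x^2/2)) := by
    congr 1; ext x; ring
  rw [e1, h, ← integral_neg]
  congr 1; ext x; ring

lemma gm_one : gm 1 = 0 := by
  rw [gm]
  have := integral_neg_eq_self (fun x : ℝ => x^1 * Real.exp (-x^2/2)) volume
  have h2 : (∫ x : ℝ, (-x)^1 * Real.exp (-(-x)^2/2)) = - ∫ x : ℝ, x^1 * Real.exp (-x^2/2) := by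
    rw [← integral_neg]; congr 1; ext x; simp
  rw [h2] at this
  linarith

lemma gm_zero : gm 0 = (2*Real.pi)^(1/2:ℝ) := by
  have := integral_gaussian (1/2)
  rw [gm, ← Real.sqrt_eq_rpow]
  rw [show Real.pi/(1/2) = 2*Real.pi by ring] at this
  rw [← this]; congr 1; ext x; rw [pow_zero, one_mul]; congr 1; ring

variable {d : ℕ}

def emb (x : EuclideanSpace ℝ (Fin d)) : Fin d → ℂ := fun i => (x i : ℂ)

def gInt (p : MvPolynomial (Fin d) ℂ) (x : EuclideanSpace ℝ (Fin d)) : ℂ :=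
  eval (emb x) p * (Real.exp (-‖x‖^2/2) : ℂ)

lemma gInt_monomial (s : Fin d →₀ ℕ) (c : ℂ) (x : EuclideanSpace ℝ (Fin d)) :
    gInt (monomial s c) x = c * ∏ i, (((x i)^(s i) * Real.exp (-(x i)^2/2) : ℝ) : ℂ) := by
  rw [gInt, eval_monomial, mul_assoc]
  congr 1
  rw [EuclideanSpace.norm_sq_eq, Finsupp.prod_fintype _ _ (by simp)]
  have : Real.exp (-(∑ i, ‖x i‖^2)/2) = ∏ i, Real.exp (-(x i)^2/2) := by
    rw [← Real.exp_sum]; congr 1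
    simp [neg_div, Finset.sum_div]
  rw [this]
  push_cast
  rw [← Finset.prod_mul_distrib]
  simp [emb]

lemma gInt_monomial_integrable (s : Fin d →₀ ℕ) (c : ℂ) :
    Integrable (gInt (monomial s c)) := by
  rw [funext (gInt_monomial s c)]
  refine Integrable.const_mul ?_ c
  have h := Integrable.fintype_prod (ι := Fin d) (μ := fun _ => (volume : Measure ℝ))
    (f := fun i (x:ℝ) => ((x^(s i) * Real.exp (-x^2/2) : ℝ) : ℂ)) (fun i => (gm_integrable (s i)).ofReal)
  exact (EuclideanSpace.volume_preserving_symm_measurableEquiv_toLp (Fin d)).integrable_comp_of_integrable h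

lemma gInt_monomial_integral (s : Fin d →₀ ℕ) (c : ℂ) :
    ∫ x, gInt (monomial s c) x = c * ∏ i, (gm (s i) : ℂ) := by
  rw [funext (gInt_monomial s c), integral_const_mul]
  congr 1
  have h := integral_fintype_prod_volume_eq_prod (ι := Fin d)
    (f := fun i (x:ℝ) => ((x^(s i) * Real.exp (-x^2/2) : ℝ) : ℂ))
  have h2 := (EuclideanSpace.volume_preserving_symm_measurableEquiv_toLp (Fin d)).integral_comp'
    (fun x : Fin d → ℝ => ∏ i, ((x i^(s i) * Real.exp (-(x i)^2/2) : ℝ) : ℂ))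
  refine h2.trans (h.trans ?_)
  congr 1; ext i
  rw [gm, integral_complex_ofReal]

lemma gInt_add (p q : MvPolynomial (Fin d) ℂ) : gInt (p+q) = gInt p + gInt q := by
  ext x; simp [gInt, add_mul]

lemma gInt_integrable (p : MvPolynomial (Fin d) ℂ) : Integrable (gInt p) := by
  induction p using MvPolynomial.induction_on' with
  | monomial s c => exact gInt_monomial_integrable s c
  | add p q hp hq => rw [gInt_add]; exact hp.add hq

def gL : MvPolynomial (Fin d) ℂ →ₗ[ℂ] ℂ where
  toFun p := ∫ x, gInt p x
  map_add' p q := by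
    rw [gInt_add]; exact integral_add (gInt_integrable p) (gInt_integrable q)
  map_smul' c p := by
    simp only [RingHom.id_apply, smul_eq_mul]
    rw [← integral_const_mul]
    congr 1; ext x; simp [gInt, smul_eval, mul_assoc]

lemma gL_apply (p : MvPolynomial (Fin d) ℂ) : gL p = ∫ x, gInt p x := rfl

lemma gL_one : gL (1 : MvPolynomial (Fin d) ℂ) = (((2*Real.pi)^((d:ℝ)/2) : ℝ) : ℂ) := by
  have := gInt_monomial_integral (d := d) 0 1
  rw [gL_apply, show (1 : MvPolynomial (Fin d) ℂ) = monomial 0 1 from rfl, this]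
  simp [gm_zero]
  rw [← Complex.ofReal_pow, ← Real.rpow_natCast, ← Real.rpow_mul (by positivity)]
  congr 2; ring

lemma gL_X_mul (i : Fin d) (p : MvPolynomial (Fin d) ℂ) : gL (X i * p) = gL (pderiv i p) := by
  induction p using MvPolynomial.induction_on' with
  | add p q hp hq => rw [mul_add, map_add, hp, hq, map_add, map_add]
  | monomial s c =>
    rw [X, monomial_mul, pderiv_monomial, gL_apply, gL_apply, gInt_monomial_integral,
      gInt_monomial_integral, one_mul, mul_assoc]
    congr 1
    rw [← Finset.mul_prod_erase _ _ (Finset.mem_univ i), ← Finset.mul_prod_erase _ _ (Finset.mem_univ i),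
      ← mul_assoc]
    congr 1
    · simp
      rcases h : s i with _ | _ | n
      · simp [gm_one]
      · have := gm_succ 0
        norm_num at this
        simp [this]
      · rw [show 1 + (n+1+1) = n+1+2 by ring, gm_succ]; simp
    · refine Finset.prod_congr rfl fun j hj => ?_
      have : i ≠ j := (Finset.ne_of_mem_erase hj).symm
      simp [this]

end Gauss
end

noncomputable section
section Harm
open MvPolynomial
variable {d : ℕ}

def cdot (a b : Fin d → ℂ) : ℂ := ∑ i, a i * b i

def lin (a : Fin d → ℂ) : MvPolynomial (Fin d) ℂ := ∑ i, C (a i) * X i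

def qq : MvPolynomial (Fin d) ℂ := ∑ i, X i * X i

def lap (p : MvPolynomial (Fin d) ℂ) : MvPolynomial (Fin d) ℂ := ∑ i, pderiv i (pderiv i p)

def dirD (a : Fin d → ℂ) (p : MvPolynomial (Fin d) ℂ) : MvPolynomial (Fin d) ℂ :=
  ∑ i, C (a i) * pderiv i p

lemma dirD_mul (a : Fin d → ℂ) (p q : MvPolynomial (Fin d) ℂ) :
    dirD a (p * q) = dirD a p * q + p * dirD a q := by
  simp only [dirD, Finset.sum_mul, Finset.mul_sum, ← Finset.sum_add_distrib]
  refine Finset.sum_congr rfl fun i _ => ?_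
  rw [pderiv_mul]; ring

lemma pderiv_lin (a : Fin d → ℂ) (i : Fin d) : pderiv i (lin a) = C (a i) := by
  simp [lin, pderiv_X, Pi.single_apply]

lemma pderiv_qq (i : Fin d) : pderiv i (qq : MvPolynomial (Fin d) ℂ) = C 2 * X i := by
  simp [qq, pderiv_X, Pi.single_apply, Finset.sum_add_distrib]
  rw [map_ofNat]; ring

lemma dirD_lin (a b : Fin d → ℂ) : dirD a (lin b) = C (cdot a b) := by
  simp [dirD, pderiv_lin, cdot]

lemma dirD_lin_pow (a : Fin d → ℂ) (n : ℕ) :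
    dirD a (lin a ^ n) = C (n * cdot a a) * lin a ^ (n-1) := by
  simp only [dirD, pderiv_pow, pderiv_lin, cdot, map_mul, map_sum, Finset.mul_sum, Finset.sum_mul]
  refine Finset.sum_congr rfl fun i _ => ?_
  rw [map_natCast]; ring

lemma pderiv_comm' (i j : Fin d) (p : MvPolynomial (Fin d) ℂ) :
    pderiv i (pderiv j p) = pderiv j (pderiv i p) := by
  have h : ⁅(pderiv i : Derivation ℂ (MvPolynomial (Fin d) ℂ) (MvPolynomial (Fin d) ℂ)), (pderiv j : Derivation ℂ (MvPolynomial (Fin d) ℂ) (MvPolynomial (Fin d) ℂ))⁆ = (0 : Derivation ℂ (MvPolynomial (Fin d) ℂ) (MvPolynomial (Fin d) ℂ)) := by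
    apply MvPolynomial.derivation_ext
    intro k
    rw [Derivation.commutator_apply]
    simp only [pderiv_X, Pi.single_apply]
    split_ifs <;> simp
  have := congrArg (fun D => D p) h
  simp only [Derivation.commutator_apply, Derivation.coe_zero, Pi.zero_apply] at this
  exact sub_eq_zero.mp this

lemma lap_dirD (a : Fin d → ℂ) (p : MvPolynomial (Fin d) ℂ) (h : lap p = 0) :
    lap (dirD a p) = 0 := by
  have : lap (dirD a p) = dirD a (lap p) := by
    simp only [lap, dirD, map_sum, Finset.mul_sum]
    rw [Finset.sum_comm]
    refine Finset.sum_congr rfl fun i _ => Finset.sum_congr rfl fun j _ => ?_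
    rw [pderiv_C_mul, pderiv_C_mul, pderiv_comm' j i, pderiv_comm' j i]
  rw [this, h]; simp [dirD]

lemma gL_lin_mul (a : Fin d → ℂ) (p : MvPolynomial (Fin d) ℂ) :
    gL (lin a * p) = gL (dirD a p) := by
  simp only [lin, dirD, Finset.sum_mul, map_sum]
  refine Finset.sum_congr rfl fun i _ => ?_
  rw [mul_assoc, C_mul', C_mul', map_smul, map_smul, gL_X_mul]

lemma dirD_homog (a : Fin d → ℂ) {p : MvPolynomial (Fin d) ℂ} {n : ℕ} (h : p.IsHomogeneous n) :
    (dirD a p).IsHomogeneous (n-1) := by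
  refine IsHomogeneous.sum _ _ _ fun i _ => ?_
  exact (h.pderiv).C_mul (a i)

lemma eval_dirD (a : Fin d → ℂ) {p : MvPolynomial (Fin d) ℂ} {n : ℕ} (h : p.IsHomogeneous n) :
    eval a (dirD a p) = n * eval a p := by
  have := congrArg (eval a) h.sum_X_mul_pderiv
  simpa [dirD] using this

lemma gL_harm {p : MvPolynomial (Fin d) ℂ} {n : ℕ} (h : p.IsHomogeneous (n+1)) (hl : lap p = 0) :
    gL p = 0 := by
  have := congrArg gL h.sum_X_mul_pderiv
  rw [map_sum, map_nsmul] at this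
  simp only [gL_X_mul] at this
  rw [← map_sum, show (∑ i, pderiv i (pderiv i p)) = lap p from rfl, hl, map_zero] at this
  rw [eq_comm, smul_eq_zero] at this
  simpa using this

lemma homog_zero {p : MvPolynomial (Fin d) ℂ} (h : p.IsHomogeneous 0) : ∃ c, p = C c :=
  ⟨_, totalDegree_eq_zero_iff_eq_C.mp (Nat.le_zero.mp h.totalDegree_le)⟩

lemma gL_rec (a : Fin d → ℂ) (p : MvPolynomial (Fin d) ℂ) (n : ℕ) :
    gL (p * lin a ^ (n+1)) = gL (dirD a p * lin a ^ n) + n * cdot a a * gL (p * lin a ^ (n-1)) := by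
  rw [show p * lin a ^ (n+1) = lin a * (p * lin a ^ n) by ring, gL_lin_mul, dirD_mul, map_add,
    dirD_lin_pow, show p * (C (n * cdot a a) * lin a ^ (n-1)) = C (n * cdot a a) * (p * lin a ^ (n-1)) by ring,
    C_mul', map_smul, smul_eq_mul]

lemma gL_low (a : Fin d → ℂ) (n : ℕ) : ∀ (p : MvPolynomial (Fin d) ℂ) (ℓ : ℕ),
    p.IsHomogeneous ℓ → lap p = 0 → n < ℓ → gL (p * lin a ^ n) = 0 := by
  induction n using Nat.strong_induction_on with
  | _ n ih =>
    intro p ℓ hp hl hn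
    obtain ⟨m, rfl⟩ : ∃ m, ℓ = m+1 := ⟨ℓ-1, by omega⟩
    cases n with
    | zero => simpa using gL_harm hp hl
    | succ n =>
      rw [gL_rec, ih n (by omega) _ m (dirD_homog a hp) (lap_dirD a p hl) (by omega),
        ih (n-1) (by omega) p _ hp hl (by omega)]
      simp

lemma gL_odd (a : Fin d → ℂ) (n : ℕ) : ∀ (p : MvPolynomial (Fin d) ℂ) (ℓ k : ℕ),
    p.IsHomogeneous ℓ → lap p = 0 → n = ℓ+2*k+1 → gL (p * lin a ^ n) = 0 := by
  induction n using Nat.strong_induction_on with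
  | _ n ih =>
    intro p ℓ k hp hl hn
    cases n with
    | zero => omega
    | succ n =>
      have h1 : gL (dirD a p * lin a ^ n) = 0 := by
        cases ℓ with
        | zero =>
          obtain ⟨c, rfl⟩ := homog_zero hp
          simp [dirD]
        | succ m => exact ih n (by omega) _ m k (dirD_homog a hp) (lap_dirD a p hl) (by omega)
      have h2 : n * cdot a a * gL (p * lin a ^ (n-1)) = 0 := by
        cases k with
        | zero =>
          rcases Nat.eq_zero_or_pos n with h0 | h0
          · simp [h0]
          · rw [gL_low a (n-1) p ℓ hp hl (by omega), mul_zero]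
        | succ k => rw [ih (n-1) (by omega) p ℓ k hp hl (by omega), mul_zero]
      rw [gL_rec, h1, h2, add_zero]

lemma gL_main (a : Fin d → ℂ) (n : ℕ) : ∀ (p : MvPolynomial (Fin d) ℂ) (ℓ k : ℕ),
    p.IsHomogeneous ℓ → lap p = 0 → n = ℓ+2*k →
    gL (p * lin a ^ n) * (k.factorial * 2^k) =
      gL (1 : MvPolynomial (Fin d) ℂ) * n.factorial * (cdot a a)^k * eval a p := by
  induction n using Nat.strong_induction_on with
  | _ n ih =>
    intro p ℓ k hp hl hn
    cases n with
    | zero =>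
      obtain ⟨rfl, rfl⟩ : ℓ = 0 ∧ k = 0 := by omega
      obtain ⟨c, rfl⟩ := homog_zero hp
      simp
      rw [show (C c : MvPolynomial (Fin d) ℂ) = c • 1 by rw [← C_mul']; simp, map_smul, smul_eq_mul]
      ring
    | succ n =>
      have h1 : gL (dirD a p * lin a ^ n) * (k.factorial * 2^k) =
          ℓ * gL (1 : MvPolynomial (Fin d) ℂ) * n.factorial * (cdot a a)^k * eval a p := by
        cases ℓ with
        | zero =>
          obtain ⟨c, rfl⟩ := homog_zero hp
          simp [dirD]
        | succ m =>
          rw [ih n (by omega) _ m k (dirD_homog a hp) (lap_dirD a p hl) (by omega),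
            eval_dirD a hp]
          ring
      have h2 : n * cdot a a * gL (p * lin a ^ (n-1)) * (k.factorial * 2^k) =
          2 * k * gL (1 : MvPolynomial (Fin d) ℂ) * n.factorial * (cdot a a)^k * eval a p := by
        cases k with
        | zero =>
          rcases Nat.eq_zero_or_pos n with h0 | h0
          · simp [h0]
          · rw [gL_low a (n-1) p ℓ hp hl (by omega)]; simp
        | succ k =>
          have := ih (n-1) (by omega) p ℓ k hp hl (by omega)
          obtain ⟨m, rfl⟩ : ∃ m, n = m+1 := ⟨n-1, by omega⟩
          rw [Nat.add_sub_cancel] at this ⊢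
          rw [Nat.factorial_succ, Nat.factorial_succ]
          push_cast
          linear_combination (2*((k:ℂ)+1)*(m+1)*cdot a a) * this
      have hn' : (n:ℂ) + 1 = ℓ + 2*k := by exact_mod_cast hn
      rw [gL_rec, Nat.factorial_succ]
      push_cast
      rw [hn']
      linear_combination h1 + h2

lemma lin_homog (a : Fin d → ℂ) : (lin a).IsHomogeneous 1 :=
  IsHomogeneous.sum _ _ _ fun i _ => (isHomogeneous_X ℂ i).C_mul (a i)

lemma qq_homog : (qq : MvPolynomial (Fin d) ℂ).IsHomogeneous 2 :=
  IsHomogeneous.sum _ _ _ fun i _ => (isHomogeneous_X ℂ i).mul (isHomogeneous_X ℂ i)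

def zh (P : Polynomial ℂ) (ℓ : ℕ) (b : Fin d → ℂ) : MvPolynomial (Fin d) ℂ :=
  ∑ j ∈ Finset.range (ℓ/2+1), C (P.coeff (ℓ-2*j) * (cdot b b)^j) * (lin b ^ (ℓ-2*j) * qq ^ j)

lemma zh_homog (P : Polynomial ℂ) (ℓ : ℕ) (b : Fin d → ℂ) : (zh P ℓ b).IsHomogeneous ℓ := by
  refine IsHomogeneous.sum _ _ _ fun j hj => ?_
  simp at hj
  refine IsHomogeneous.C_mul ?_ _
  have := ((lin_homog b).pow (ℓ-2*j)).mul ((qq_homog (d := d)).pow j)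
  convert! this using 1; omega

lemma lap_term (b : Fin d → ℂ) (m j : ℕ) : lap (lin b ^ m * qq ^ j) =
    C ((m:ℂ) * (m-1) * cdot b b) * (lin b ^ (m-2) * qq ^ j) +
      C (2*(j:ℂ)*(2*m+2*j-2+d)) * (lin b ^ m * qq ^ (j-1)) := by
  have h1 : ∀ i, pderiv i (pderiv i (lin b ^ m * qq ^ j)) =
      C ((m:ℂ) * (m-1)) * C (b i * b i) * (lin b ^ (m-2) * qq ^ j) +
      C (4*(m:ℂ)*j) * lin b ^ (m-1) * qq ^ (j-1) * (C (b i) * X i) +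
      C (4*(j:ℂ)*(j-1)) * lin b ^ m * qq ^ (j-2) * (X i * X i) + C (2*(j:ℂ)) * lin b ^ m * qq^(j-1) := by
    intro i
    have em : ((m-1:ℕ):ℂ) * m = m * (m-1) := by cases m <;> simp; ring
    have ej : ((j-1:ℕ):ℂ) * j = j * (j-1) := by cases j <;> simp; ring
    have em' := congrArg (C : ℂ → MvPolynomial (Fin d) ℂ) em
    have ej' := congrArg (C : ℂ → MvPolynomial (Fin d) ℂ) ej
    simp only [pderiv_mul, pderiv_pow, pderiv_lin, pderiv_qq, map_add, pderiv_C, pderiv_X_self,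
      Derivation.map_natCast]
    simp only [map_mul, map_sub, map_natCast, map_one, map_ofNat, show m-1-1 = m-2 by omega,
      show j-1-1 = j-2 by omega] at em' ej' ⊢
    linear_combination (C (b i) * C (b i) * (lin b ^ (m-2) * qq ^ j)) * em' +
      (4 * lin b ^ m * qq ^ (j-2) * (X i * X i)) * ej'
  have hl : (∑ i, C (b i) * X i) = lin b := rfl
  have hq : (∑ i, X i * X i) = (qq : MvPolynomial (Fin d) ℂ) := rfl
  have hc : (∑ i, C (b i * b i)) = (C (cdot b b) : MvPolynomial (Fin d) ℂ) := by rw [← map_sum]; rfl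
  rw [lap, Finset.sum_congr rfl (fun i _ => h1 i)]
  simp only [Finset.sum_add_distrib, ← Finset.mul_sum, ← Finset.sum_mul, hl, hq, hc]
  have e1 : C (4*(m:ℂ)*j) * lin b ^ (m-1) * qq ^ (j-1) * lin b =
      C (4*(m:ℂ)*j) * (lin b ^ m * qq ^ (j-1)) := by
    cases m with
    | zero => simp
    | succ m => simp; ring
  have e2 : C (4*(j:ℂ)*(j-1)) * lin b ^ m * qq ^ (j-2) * qq =
      C (4*(j:ℂ)*(j-1)) * (lin b ^ m * qq ^ (j-1)) := by
    rcases j with _ | _ | j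
    · simp
    · simp
    · simp; ring
  rw [e1, e2]
  simp
  simp only [map_ofNat]
  ring

lemma zh_lap {ℓ : ℕ} {P : Polynomial ℂ} (hP : IsLegendre d ℓ P) (b : Fin d → ℂ) :
    lap (zh P ℓ b) = 0 := by
  have hs : lap (zh P ℓ b) = ∑ j ∈ Finset.range (ℓ/2+1),
      C (P.coeff (ℓ-2*j) * (cdot b b)^j) * lap (lin b ^ (ℓ-2*j) * qq ^ j) := by
    simp only [lap, zh, map_sum, pderiv_C_mul]
    rw [Finset.sum_comm]
    simp only [Finset.mul_sum]
  rw [hs]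
  simp only [lap_term, mul_add, Finset.sum_add_distrib]
  rw [Finset.sum_range_succ, Finset.sum_range_succ' _ (ℓ/2)]
  have z1 : (((ℓ - 2*(ℓ/2) : ℕ):ℂ) * ((ℓ - 2*(ℓ/2) : ℕ) - 1)) = 0 := by
    rcases Nat.mod_two_eq_zero_or_one ℓ with h | h
    · rw [show ℓ - 2*(ℓ/2) = 0 by omega]; simp
    · rw [show ℓ - 2*(ℓ/2) = 1 by omega]; simp
  rw [z1]
  simp only [zero_mul, Nat.cast_zero, mul_zero, map_zero, add_zero]
  rw [← Finset.sum_add_distrib]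
  refine Finset.sum_eq_zero fun j hj => ?_
  simp at hj
  obtain ⟨m, hm⟩ : ∃ m, ℓ = m + 2 + 2*j := ⟨ℓ-2-2*j, by omega⟩
  have hr := isLegendre_rec hP m
  rw [show ℓ - 2*j = m+2 by omega, show ℓ - 2*(j+1) = m by omega, Nat.add_sub_cancel, Nat.add_sub_cancel]
  have : P.coeff (m+2) * (cdot b b)^j * (((m+2:ℕ):ℂ) * ((m+2:ℕ)-1) * cdot b b) +
    P.coeff m * (cdot b b)^(j+1) * (2 * ((j+1:ℕ):ℂ) * (2*m+2*((j+1:ℕ):ℂ)-2+d)) = 0 := by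
    rw [hm] at hr
    push_cast at hr ⊢
    linear_combination (cdot b b)^(j+1) * hr
  have this' := congrArg (C : ℂ → MvPolynomial (Fin d) ℂ) this
  simp only [map_mul, map_add, map_sub, map_zero, map_pow] at this' ⊢
  linear_combination (lin b ^ m * qq ^ j) * this'

lemma eval_lin (a b : Fin d → ℂ) : eval a (lin b) = cdot b a := by simp [lin, cdot]
lemma eval_qq (a : Fin d → ℂ) : eval a qq = cdot a a := by simp [qq, cdot]

lemma eval_zh (P : Polynomial ℂ) (ℓ : ℕ) (a b : Fin d → ℂ) : eval a (zh P ℓ b) =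
    ∑ j ∈ Finset.range (ℓ/2+1), P.coeff (ℓ-2*j) * (cdot b b)^j * ((cdot b a) ^ (ℓ-2*j) * (cdot a a) ^ j) := by
  simp [zh, eval_lin, eval_qq]

lemma cdot_comm (a b : Fin d → ℂ) : cdot a b = cdot b a := by simp [cdot, mul_comm]

lemma eval_zh_comm (P : Polynomial ℂ) (ℓ : ℕ) (a b : Fin d → ℂ) :
    eval a (zh P ℓ b) = eval b (zh P ℓ a) := by
  rw [eval_zh, eval_zh]
  refine Finset.sum_congr rfl fun j _ => ?_
  rw [cdot_comm b a]; ring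

end Harm
end

noncomputable section
section Sph
open MvPolynomial
variable {d : ℕ}

def sInt (p : MvPolynomial (Fin d) ℂ) : ℂ :=
  ∫ y : Metric.sphere (0 : EuclideanSpace ℝ (Fin d)) 1, eval (emb y.1) p ∂ sphMeasure d

instance : IsFiniteMeasure (sphMeasure d) := by unfold sphMeasure; infer_instance

def rad (d N : ℕ) : ℝ := 2^(((N:ℝ)+d)/2-1) * Real.Gamma (((N:ℝ)+d)/2)

lemma rad_integral (d N : ℕ) (hd : 2 ≤ d) :
    ∫ x in Set.Ioi (0:ℝ), x^(d-1) * (x^N * Real.exp (-x^2/2)) = rad d N := by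
  have h := integral_rpow_mul_exp_neg_mul_rpow (p := 2) (q := (d-1+N:ℕ)) (b := 1/2) (by norm_num)
    (by have : (0:ℝ) ≤ (d-1+N:ℕ) := by positivity
        linarith) (by norm_num)
  have e : ∫ x in Set.Ioi (0:ℝ), x^(d-1) * (x^N * Real.exp (-x^2/2)) =
      ∫ x in Set.Ioi (0:ℝ), x ^ (((d-1+N:ℕ)):ℝ) * Real.exp (-(1/2) * x ^ (2:ℝ)) := by
    congr 1; ext x
    rw [Real.rpow_natCast, Real.rpow_two, pow_add, mul_assoc]
    congr 3; ring
  rw [e, h, rad]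
  have e2 : (((d-1+N:ℕ):ℝ)+1) = N + d := by
    rw [← Nat.cast_succ, show (d-1+N).succ = N + d by omega]; push_cast; rfl
  rw [e2, Real.rpow_sub_one (by norm_num), neg_div, Real.rpow_neg (by norm_num), ← Real.inv_rpow (by norm_num)]
  rw [show ((1/2:ℝ))⁻¹ = 2 by norm_num]
  ring

lemma eval_smul_homog {p : MvPolynomial (Fin d) ℂ} {N : ℕ} (hp : p.IsHomogeneous N)
    (c : ℝ) (x : EuclideanSpace ℝ (Fin d)) :
    eval (emb (c • x)) p = (c:ℂ)^N * eval (emb x) p := by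
  have h : emb (c • x) = (c:ℂ) • emb x := by ext i; simp [emb]
  rw [h, eval_eq', eval_eq', Finset.mul_sum]
  refine Finset.sum_congr rfl fun s hs => ?_
  have hN : ∑ i, s i = N := by
    have := hp (mem_support_iff.mp hs)
    rw [← this, Finsupp.weight_apply, Finsupp.sum_fintype _ _ (by simp)]; simp
  simp only [Pi.smul_apply, smul_eq_mul, mul_pow, Finset.prod_mul_distrib, Finset.prod_pow_eq_pow_sum, hN]
  ring

lemma gL_eq_sInt (hd : 2 ≤ d) {p : MvPolynomial (Fin d) ℂ} {N : ℕ} (hp : p.IsHomogeneous N) :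
    gL p = rad d N * sInt p := by
  have hdim : Module.finrank ℝ (EuclideanSpace ℝ (Fin d)) = d := by simp
  have hN : Nontrivial (EuclideanSpace ℝ (Fin d)) := by
    apply Module.nontrivial_of_finrank_pos (R := ℝ); rw [hdim]; omega
  let μ : Measure (EuclideanSpace ℝ (Fin d)) := volume
  calc gL p = ∫ x : ({(0)}ᶜ : Set (EuclideanSpace ℝ (Fin d))), gInt p x.1 ∂(μ.comap (↑)) := by
        rw [integral_subtype_comap (measurableSet_singleton _).compl (fun x => gInt p x),
          restrict_compl_singleton]; rfl
    _ = ∫ x, eval (emb x.1.1) p * ((x.2.1^N * Real.exp (-x.2.1^2/2) : ℝ):ℂ)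
          ∂μ.toSphere.prod (.volumeIoiPow (d - 1)) := by
        have h := μ.measurePreserving_homeomorphUnitSphereProd.integral_comp
          (Homeomorph.measurableEmbedding _)
          (fun x => eval (emb x.1.1) p * ((x.2.1^N * Real.exp (-x.2.1^2/2) : ℝ):ℂ))
        rw [hdim] at h
        rw [← h]
        congr 1; ext x
        have hx : ‖x.1‖ ≠ 0 := norm_ne_zero_iff.mpr x.2
        simp only [homeomorphUnitSphereProd_apply_fst_coe, homeomorphUnitSphereProd_apply_snd_coe]
        rw [eval_smul_homog hp, gInt]
        push_cast
        have hx' : (‖x.1‖:ℂ) ≠ 0 := by exact_mod_cast hx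
        field_simp
        rw [mul_assoc, ← mul_pow, one_div, inv_mul_cancel₀ hx', one_pow, mul_one]
    _ = sInt p * ∫ x : Set.Ioi (0 : ℝ), ((x.1^N * Real.exp (-x.1^2/2) : ℝ):ℂ) ∂.volumeIoiPow (d - 1) := by
        rw [integral_prod_mul (fun y : Metric.sphere (0 : EuclideanSpace ℝ (Fin d)) 1 => eval (emb y.1) p)
          (fun x : Set.Ioi (0:ℝ) => ((x.1^N * Real.exp (-x.1^2/2) : ℝ):ℂ))]
        rfl
    _ = _ := by
        rw [mul_comm]
        congr 1
        rw [integral_complex_ofReal, ← rad_integral d N hd]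
        congr 1
        simp only [Measure.volumeIoiPow, ENNReal.ofReal]
        rw [integral_withDensity_eq_integral_smul,
          integral_subtype_comap measurableSet_Ioi fun a ↦ Real.toNNReal (a ^ (d - 1)) • (a^N * Real.exp (-a^2/2)),
          setIntegral_congr_fun measurableSet_Ioi fun x hx ↦ ?_]
        · rw [NNReal.smul_def, Real.coe_toNNReal _ (pow_nonneg hx.out.le _), smul_eq_mul]
        · exact (measurable_subtype_coe.pow_const _).real_toNNReal

lemma rad_pos (hd : 2 ≤ d) (N : ℕ) : 0 < rad d N := by
  have : (2:ℝ) ≤ d := by exact_mod_cast hd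
  have h0 : (0:ℝ) ≤ N := by positivity
  exact mul_pos (by positivity) (Real.Gamma_pos_of_pos (by linarith))

lemma sInt_zero (hd : 2 ≤ d) (a : Fin d → ℂ) {p : MvPolynomial (Fin d) ℂ} {ℓ : ℕ}
    (hp : p.IsHomogeneous ℓ) (hl : lap p = 0) (n : ℕ) (hn : ∀ k, ℓ + 2*k ≠ n) :
    sInt (p * lin a ^ n) = 0 := by
  have h1 : gL (p * lin a ^ n) = 0 := by
    by_cases h : n < ℓ
    · exact gL_low a n p ℓ hp hl h
    · have := hn ((n-ℓ)/2)
      exact gL_odd a n p ℓ ((n-ℓ)/2) hp hl (by omega)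
  rw [gL_eq_sInt hd (hp.mul ((lin_homog a).pow n))] at h1
  have := (rad_pos hd (ℓ + 1*n)).ne'
  rcases mul_eq_zero.mp h1 with h | h
  · exact absurd (by exact_mod_cast h) this
  · exact h

lemma sInt_main (hd : 2 ≤ d) (a : Fin d → ℂ) {p : MvPolynomial (Fin d) ℂ} {ℓ : ℕ}
    (hp : p.IsHomogeneous ℓ) (hl : lap p = 0) (k : ℕ) :
    sInt (p * lin a ^ (ℓ+2*k)) = (((2*Real.pi)^((d:ℝ)/2) : ℝ) : ℂ) * (ℓ+2*k).factorial *
      ((cdot a a)^k / (k.factorial * 2^k * rad d (ℓ+1*(ℓ+2*k)))) * eval a p := by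
  have h := gL_main a (ℓ+2*k) p ℓ k hp hl rfl
  rw [gL_eq_sInt hd (hp.mul ((lin_homog a).pow (ℓ+2*k))), gL_one] at h
  have h1 : (rad d (ℓ+1*(ℓ+2*k)) : ℂ) ≠ 0 := by exact_mod_cast (rad_pos hd _).ne'
  have h2 : (k.factorial : ℂ) ≠ 0 := by exact_mod_cast k.factorial_ne_zero
  field_simp
  linear_combination h

lemma continuous_eval_emb (p : MvPolynomial (Fin d) ℂ) :
    Continuous (fun y : Metric.sphere (0 : EuclideanSpace ℝ (Fin d)) 1 => eval (emb y.1) p) := by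
  refine (MvPolynomial.continuous_eval p).comp ?_
  refine continuous_pi fun i => ?_
  unfold emb
  fun_prop

lemma sphere_bound (p : MvPolynomial (Fin d) ℂ) : ∃ M : ℝ,
    ∀ y : Metric.sphere (0 : EuclideanSpace ℝ (Fin d)) 1, ‖eval (emb y.1) p‖ ≤ M := by
  obtain ⟨M, hM⟩ := isCompact_univ.exists_bound_of_continuousOn (continuous_eval_emb p).continuousOn
  exact ⟨M, fun y => hM y (Set.mem_univ _)⟩

lemma sInt_integrable (p : MvPolynomial (Fin d) ℂ) :
    Integrable (fun y : Metric.sphere (0 : EuclideanSpace ℝ (Fin d)) 1 => eval (emb y.1) p) (sphMeasure d) := by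
  obtain ⟨M, hM⟩ := sphere_bound p
  exact Integrable.of_bound (continuous_eval_emb p).aestronglyMeasurable M (Filter.Eventually.of_forall hM)

lemma exp_hasSum (a : Fin d → ℂ) (p : MvPolynomial (Fin d) ℂ) :
    HasSum (fun n : ℕ => sInt (p * lin a ^ n) / n.factorial)
      (∫ y : Metric.sphere (0 : EuclideanSpace ℝ (Fin d)) 1,
        eval (emb y.1) p * Complex.exp (cdot a (emb y.1)) ∂ sphMeasure d) := by
  obtain ⟨M, hM⟩ := sphere_bound p
  obtain ⟨B, hB⟩ := sphere_bound (lin a)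
  have h := hasSum_integral_of_dominated_convergence (μ := sphMeasure d)
    (F := fun (n:ℕ) (y : Metric.sphere (0 : EuclideanSpace ℝ (Fin d)) 1) =>
      eval (emb y.1) (p * lin a ^ n) / n.factorial)
    (f := fun y => eval (emb y.1) p * Complex.exp (cdot a (emb y.1)))
    (fun n _ => M * (B^n / n.factorial))
    (fun n => ((continuous_eval_emb (p * lin a ^ n)).div_const _).aestronglyMeasurable)
    (fun n => Filter.Eventually.of_forall fun y => by
      have h0 := norm_nonneg (eval (emb y.1) p)
      have h1 := norm_nonneg (eval (emb y.1) (lin a))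
      simp only [map_mul, map_pow, norm_div, norm_mul, norm_pow, Complex.norm_natCast]
      rw [← mul_div_assoc]
      have := hM y
      have := hB y
      gcongr
      exact h0.trans (hM y))
    (Filter.Eventually.of_forall fun y => (Real.summable_pow_div_factorial B).mul_left M)
    (integrable_const _)
    (Filter.Eventually.of_forall fun y => by
      have := (NormedSpace.expSeries_div_hasSum_exp (cdot a (emb y.1))).mul_left (eval (emb y.1) p)
      rw [← Complex.exp_eq_exp_ℂ] at this
      refine this.congr_fun ?_
      intro n
      simp [eval_lin, mul_div_assoc])
  refine h.congr_fun ?_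
  intro n
  rw [sInt, integral_div]

lemma exp_integral (hd : 2 ≤ d) (a : Fin d → ℂ) {p : MvPolynomial (Fin d) ℂ} {ℓ : ℕ}
    (hp : p.IsHomogeneous ℓ) (hl : lap p = 0) :
    ∫ y : Metric.sphere (0 : EuclideanSpace ℝ (Fin d)) 1,
        eval (emb y.1) p * Complex.exp (cdot a (emb y.1)) ∂ sphMeasure d =
    (((2*Real.pi)^((d:ℝ)/2) : ℝ) : ℂ) * eval a p *
      ∑' k : ℕ, (cdot a a)^k / (k.factorial * 2^k * rad d (ℓ+1*(ℓ+2*k))) := by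
  have h := exp_hasSum a p
  have hinj : Function.Injective (fun k : ℕ => ℓ + 2*k) := by intro x y h; simpa using h
  rw [← hinj.hasSum_iff] at h
  · rw [← h.tsum_eq, ← tsum_mul_left]
    congr 1; ext k
    simp only [Function.comp]
    rw [sInt_main hd a hp hl k]
    have h2 : ((ℓ+2*k).factorial : ℂ) ≠ 0 := by exact_mod_cast (ℓ+2*k).factorial_ne_zero
    field_simp
  · intro n hn
    rw [sInt_zero hd a hp hl n, zero_div]
    intro k hk
    exact hn ⟨k, hk⟩

lemma phi_sum (d ℓ : ℕ) (u z : ℂ) (hu : u = -z^2) :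
    z^ℓ * ∑' k : ℕ, u^k / (k.factorial * 2^k * rad d (ℓ+1*(ℓ+2*k))) = phiF d ℓ z := by
  rw [phiF, div_mul_eq_mul_div, mul_div_assoc]
  congr 1
  rw [← tsum_div_const]
  congr 1; ext k
  have e0 : ((ℓ+1*(ℓ+2*k):ℕ):ℝ) + d = 2*((ℓ:ℝ) + (d-2)/2 + k + 1) := by push_cast; ring
  have e1 : rad d (ℓ+1*(ℓ+2*k)) = 2^((ℓ:ℝ) + ((d:ℝ)-2)/2) * 2^k * Real.Gamma ((ℓ:ℝ) + (d-2)/2 + k + 1) := by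
    rw [rad, e0, ← Real.rpow_natCast 2 k, ← Real.rpow_add (by norm_num)]
    congr 2 <;> ring
  have e2 : (2:ℂ)^((ℓ:ℂ) + ((d:ℂ)-2)/2) = ((2^((ℓ:ℝ) + ((d:ℝ)-2)/2) : ℝ) : ℂ) := by
    rw [Complex.ofReal_cpow (by norm_num)]; push_cast; rfl
  have e3 : Complex.Gamma ((ℓ:ℂ) + ((d:ℂ)-2)/2 + k + 1) = (Real.Gamma ((ℓ:ℝ) + (d-2)/2 + k + 1) : ℝ) := by
    rw [← Complex.Gamma_ofReal]; push_cast; rfl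
  rw [e1, e2, e3, hu, neg_pow, div_pow, ← pow_mul, pow_mul 2 2 k]
  push_cast
  rw [show (2:ℂ)^2 = 2*2 by norm_num, mul_pow (2:ℂ) 2 k]
  simp only [div_eq_mul_inv, mul_inv]
  ring

lemma cdot_emb_sphere (y : Metric.sphere (0 : EuclideanSpace ℝ (Fin d)) 1) :
    cdot (emb y.1) (emb y.1) = 1 := by
  have h : ‖y.1‖ = 1 := by simpa using y.2
  have h2 := EuclideanSpace.norm_sq_eq y.1
  rw [h] at h2
  simp only [Real.norm_eq_abs, sq_abs] at h2
  have h3 : (∑ i, ((y.1 i : ℝ) : ℂ)^2) = 1 := by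
    rw [one_pow] at h2
    exact_mod_cast h2.symm
  simpa [cdot, emb, sq] using h3

lemma zh_orth (hd : 2 ≤ d) {ℓ : ℕ} {P : Polynomial ℂ} (hP : IsLegendre d ℓ P) (a b : Fin d → ℂ) :
    ∫ x : Metric.sphere (0 : EuclideanSpace ℝ (Fin d)) 1,
      eval (emb x.1) (zh P ℓ a) * eval (emb x.1) (zh P ℓ b) ∂ sphMeasure d =
    P.coeff ℓ * ((((2*Real.pi)^((d:ℝ)/2) : ℝ) : ℂ) * ℓ.factorial / rad d (ℓ+ℓ)) * eval b (zh P ℓ a) := by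
  have h1 : ∀ x : Metric.sphere (0 : EuclideanSpace ℝ (Fin d)) 1,
      eval (emb x.1) (zh P ℓ a) * eval (emb x.1) (zh P ℓ b) =
      ∑ j ∈ Finset.range (ℓ/2+1), (P.coeff (ℓ-2*j) * (cdot b b)^j) *
        eval (emb x.1) (zh P ℓ a * lin b ^ (ℓ-2*j)) := by
    intro x
    rw [eval_zh P ℓ (emb x.1) b, Finset.mul_sum]
    refine Finset.sum_congr rfl fun j _ => ?_
    rw [cdot_emb_sphere, map_mul, map_pow, eval_lin]; ring
  simp only [h1]
  rw [integral_finsetSum _ (fun j _ => (sInt_integrable _).const_mul _)]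
  simp only [integral_const_mul]
  rw [Finset.sum_range_succ', Finset.sum_eq_zero, zero_add]
  · have := sInt_main hd b (zh_homog P ℓ a) (zh_lap hP a) 0
    rw [sInt] at this
    simp only [mul_zero, add_zero, one_mul, pow_zero, Nat.factorial_zero, Nat.cast_one, mul_one, Nat.sub_zero] at this ⊢
    rw [this]; ring
  · intro j hj
    simp at hj
    have := sInt_zero hd b (zh_homog P ℓ a) (zh_lap hP a) (ℓ - 2*(j+1)) (by intro k; omega)
    rw [sInt] at this
    rw [this, mul_zero]

lemma projector_exp (hd : 2 ≤ d) {ℓ : ℕ} {P : Polynomial ℂ} (hP : IsLegendre d ℓ P) (a : Fin d → ℂ)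
    (x : Metric.sphere (0 : EuclideanSpace ℝ (Fin d)) 1) :
    projector d ℓ P (expFun d a) x = ((Nld d ℓ : ℂ) / (sphereArea d : ℂ)) *
      ((((2*Real.pi)^((d:ℝ)/2) : ℝ) : ℂ) * eval (emb x.1) (zh P ℓ a) *
      ∑' k : ℕ, (cdot a a)^k / (k.factorial * 2^k * rad d (ℓ+1*(ℓ+2*k)))) := by
  rw [projector, eval_zh_comm, ← exp_integral hd a (zh_homog P ℓ (emb x.1)) (zh_lap hP _)]
  congr 2; ext y
  congr 1
  rw [isLegendre_eval hd hP, eval_zh]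
  refine Finset.sum_congr rfl fun j _ => ?_
  have : ((inner ℝ x.1 y.1 : ℝ) : ℂ) = cdot (emb x.1) (emb y.1) := by
    simp [PiLp.inner_apply, cdot, emb, mul_comm]
  rw [this, cdot_emb_sphere, cdot_emb_sphere]; simp

end Sph
end

theorem projection_product_integral (d : ℕ) (hd : 2 ≤ d) (ℓ : ℕ) (κ : ℂ) (hκ : κ ≠ 0)
    (r : ℝ) (hr : 0 < r) (ζ₁ ζ₂ : Fin d → ℂ)
    (h1 : ∑ i, ζ₁ i * ζ₁ i = -κ) (h2 : ∑ i, ζ₂ i * ζ₂ i = -κ)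
    (P : Polynomial ℂ) (hP : IsLegendre d ℓ P) :
    ∫ x, (projector d ℓ P (expFun d (fun i => (r : ℂ) * ζ₁ i)) x *
        projector d ℓ P (expFun d (fun i => (r : ℂ) * ζ₂ i)) x) ∂ sphMeasure d =
      (2 * (Real.pi : ℂ)) ^ d * (phiF d ℓ (κ ^ (1/2 : ℂ) * (r : ℂ))) ^ 2 *
        zonal d ℓ P ((∑ i, ζ₁ i * ζ₂ i) / κ) := by
  set a : Fin d → ℂ := fun i => (r : ℂ) * ζ₁ i with ha
  set b : Fin d → ℂ := fun i => (r : ℂ) * ζ₂ i with hb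
  set z : ℂ := κ ^ (1/2 : ℂ) * (r : ℂ) with hz
  have hκ2 : (κ ^ (1/2 : ℂ))^2 = κ := by
    rw [← Complex.cpow_nat_mul]; norm_num
  have hz2 : z^2 = κ * r^2 := by rw [hz, mul_pow, hκ2]
  have hr' : (r:ℂ) ≠ 0 := by exact_mod_cast hr.ne'
  have hz0 : z ≠ 0 := by
    intro h
    rw [h] at hz2
    have : κ * (r:ℂ)^2 ≠ 0 := mul_ne_zero hκ (pow_ne_zero _ hr')
    exact this (by rw [← hz2]; simp)
  have scal : ∀ u v : Fin d → ℂ, cdot (fun i => (r:ℂ) * u i) (fun i => (r:ℂ) * v i) = r^2 * ∑ i, u i * v i := by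
    intro u v
    rw [cdot, Finset.mul_sum]
    refine Finset.sum_congr rfl fun i _ => by ring
  have haa : cdot a a = -z^2 := by rw [ha, scal, h1, hz2]; ring
  have hbb : cdot b b = -z^2 := by rw [hb, scal, h2, hz2]; ring
  have hab : cdot a b = z^2 * ((∑ i, ζ₁ i * ζ₂ i) / κ) := by
    rw [ha, hb, scal, hz2]; field_simp
  set s := (∑ i, ζ₁ i * ζ₂ i) / κ with hs
  set S := ∑' k : ℕ, (-z^2)^k / (k.factorial * 2^k * (rad d (ℓ+1*(ℓ+2*k)) : ℂ)) with hS
  have hphi : z^ℓ * S = phiF d ℓ z := phi_sum d ℓ _ z rfl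
  have hev : MvPolynomial.eval b (zh P ℓ a) = z^(2*ℓ) * P.eval s := by
    rw [eval_zh, isLegendre_eval hd hP, Finset.mul_sum]
    refine Finset.sum_congr rfl fun j hj => ?_
    simp at hj
    rw [haa, hbb, hab]
    obtain ⟨m, hm⟩ : ∃ m, ℓ = m + 2*j := ⟨ℓ-2*j, by omega⟩
    rw [show ℓ - 2*j = m by omega, hm, mul_pow, neg_pow]
    have h : ((-1:ℂ)^j) * (-1)^j = 1 := by rw [← mul_pow]; simp
    linear_combination (P.coeff m * z^(2*(m+2*j)) * s^m) * h
  simp only [projector_exp hd hP, haa, hbb, ← hS]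
  set c : ℂ := (((2*Real.pi)^((d:ℝ)/2) : ℝ) : ℂ) with hc
  have hcc : c * c = (2 * (Real.pi:ℂ))^d := by
    rw [hc, ← Complex.ofReal_mul, ← Real.rpow_add (by positivity), add_halves, Real.rpow_natCast]
    push_cast; rfl
  set A : ℂ := (Nld d ℓ : ℂ) / (sphereArea d : ℂ) with hA
  have hint : ∀ x : Metric.sphere (0 : EuclideanSpace ℝ (Fin d)) 1,
     A * (c * MvPolynomial.eval (emb x.1) (zh P ℓ a) * S) * (A * (c * MvPolynomial.eval (emb x.1) (zh P ℓ b) * S))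
      = (A * A * (c * c) * S^2) * (MvPolynomial.eval (emb x.1) (zh P ℓ a) * MvPolynomial.eval (emb x.1) (zh P ℓ b)) := by
    intro x; ring
  simp only [hint]
  rw [integral_const_mul, zh_orth hd hP, hev, hcc, ← hphi, zonal, ← hA, ← hc]
  have key : A * (P.coeff ℓ * (c * ℓ.factorial / rad d (ℓ+ℓ))) = 1 := by
    have hci := const_identity d ℓ hd
    have er : rad d (ℓ+ℓ) = (2:ℝ)^((ℓ:ℝ) + (d:ℝ)/2 - 1) * Real.Gamma (ℓ + (d:ℝ)/2) := by
      rw [rad]; congr 2 <;> push_cast <;> ring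
    rw [← er] at hci
    have hci' := congrArg (fun t : ℝ => (t:ℂ)) hci
    simp only [Complex.ofReal_mul] at hci'
    have hlead := isLegendre_lead hP
    rw [Complex.ofReal_mul] at hlead
    rw [← hlead, ← hc] at hci'
    have r0 : (rad d (ℓ+ℓ) : ℂ) ≠ 0 := by exact_mod_cast (rad_pos hd _).ne'
    have s0 : (sphereArea d : ℂ) ≠ 0 := by
      have : (2:ℝ) ≤ d := by exact_mod_cast hd
      have h := Real.Gamma_pos_of_pos (show (0:ℝ) < d/2 by linarith)
      have : 0 < sphereArea d := by
        unfold sphereArea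
        have := Real.pi_pos
        positivity
      exact_mod_cast this.ne'
    rw [hA]
    field_simp
    push_cast at hci'
    linear_combination hci'
  linear_combination (A * (2 * (Real.pi:ℂ))^d * S^2 * z^(2*ℓ) * P.eval s) * key
end

section
/- Let d ≥ 2 be an integer, ℓ ∈ ℕ₀, and let ζ₁, ζ₂ ∈ ℂ^d satisfy ζ₁·ζ₁ = 0 and ζ₂·ζ₂ = 0 (bilinear dot product). Then ∫_{S^{d−1}} (y·ζ₁)^ℓ (y·ζ₂)^ℓ dσ(y) = (2 π^{d/2} ℓ! / Γ(ℓ + d/2)) · ((ζ₁·ζ₂)/2)^ℓ. -/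
open MeasureTheory

noncomputable section

namespace SphIso

abbrev E (d : ℕ) := EuclideanSpace ℝ (Fin d)

/-- the bilinear pairing -/
def lin {d : ℕ} (v : Fin d → ℂ) (x : E d) : ℂ := ∑ i, (x i : ℂ) * v i

/-- the Gaussian weight -/
def gw {d : ℕ} (x : E d) : ℂ := Complex.exp (-(‖x‖ : ℂ) ^ 2)

/-- continuous functions of exponential type -/
def ET {d : ℕ} (f : E d → ℂ) : Prop :=
  Continuous f ∧ ∃ C K : ℝ, 0 ≤ C ∧ 0 ≤ K ∧ ∀ x, ‖f x‖ ≤ C * Real.exp (K * ‖x‖)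

variable {d : ℕ}

lemma lin_cont (v : Fin d → ℂ) : Continuous (lin v) := by
  unfold lin; fun_prop

lemma gw_cont : Continuous (gw (d := d)) := by
  unfold gw; fun_prop

lemma lin_bound (v : Fin d → ℂ) (x : E d) : ‖lin v x‖ ≤ (∑ i, ‖v i‖) * ‖x‖ := by
  unfold lin
  rw [Finset.sum_mul]
  refine (norm_sum_le _ _).trans (Finset.sum_le_sum fun i _ => ?_)
  rw [norm_mul, mul_comm, Complex.norm_real]
  gcongr
  exact PiLp.norm_apply_le x i

lemma ET.mul {f g : E d → ℂ} (hf : ET f) (hg : ET g) : ET (fun x => f x * g x) := by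
  obtain ⟨cf, C, K, hC, hK, h⟩ := hf
  obtain ⟨cg, C', K', hC', hK', h'⟩ := hg
  refine ⟨cf.mul cg, C * C', K + K', by positivity, by positivity, fun x => ?_⟩
  rw [norm_mul, add_mul, Real.exp_add]
  calc _ ≤ (C * Real.exp (K * ‖x‖)) * (C' * Real.exp (K' * ‖x‖)) := by
        gcongr
        · exact h x
        · exact h' x
    _ = _ := by ring

lemma ET.one : ET (fun _ : E d => (1 : ℂ)) :=
  ⟨continuous_const, 1, 0, by simp, by simp, fun x => by simp⟩

lemma ET.pow {f : E d → ℂ} (hf : ET f) (n : ℕ) : ET (fun x => f x ^ n) := by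
  induction n with
  | zero => simpa using ET.one
  | succ n ih => simpa only [pow_succ] using ih.mul hf

lemma ET.lin (v : Fin d → ℂ) : ET (lin v) := by
  refine ⟨lin_cont v, ∑ i, ‖v i‖, 1, by positivity, by simp, fun x => ?_⟩
  refine (lin_bound v x).trans ?_
  gcongr
  have := Real.add_one_le_exp (1 * ‖x‖)
  linarith

lemma ET.exp_lin (v : Fin d → ℂ) : ET (fun x => Complex.exp (SphIso.lin v x)) := by
  refine ⟨(lin_cont v).cexp, 1, ∑ i, ‖v i‖, by simp, by positivity, fun x => ?_⟩
  rw [one_mul, Complex.norm_exp]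
  exact Real.exp_le_exp.2 ((Complex.re_le_norm _).trans (lin_bound v x))

lemma norm_gw (x : E d) : ‖gw x‖ = Real.exp (-‖x‖ ^ 2) := by
  rw [gw, Complex.norm_exp]
  congr 1
  norm_cast

lemma bound_integrable (C K : ℝ) :
    Integrable (fun x : E d => C * Real.exp (K * ‖x‖) * Real.exp (-‖x‖ ^ 2)) := by
  have h0 := (GaussianFourier.integrable_cexp_neg_mul_sq_norm_add (V := E d)
    (b := (1 / 2 : ℂ)) (by norm_num) 0 0).norm
  have h1 : Integrable (fun x : E d => |C| * Real.exp (K ^ 2) * Real.exp (-(1/2) * ‖x‖ ^ 2)) := by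
    refine Integrable.const_mul ?_ _
    refine h0.congr (Filter.Eventually.of_forall fun x => ?_)
    simp only [zero_mul, add_zero, Complex.norm_exp]
    congr 1
    have : (-(1 / 2) * (‖x‖ : ℂ) ^ 2) = ((-(1 / 2) * ‖x‖ ^ 2 : ℝ) : ℂ) := by push_cast; ring
    rw [this, Complex.ofReal_re]
  refine h1.mono' (by fun_prop) (Filter.Eventually.of_forall fun x => ?_)
  rw [norm_mul, norm_mul, Real.norm_eq_abs, Real.norm_eq_abs, Real.norm_eq_abs, Real.abs_exp,
    Real.abs_exp, mul_assoc, mul_assoc, ← Real.exp_add, ← Real.exp_add]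
  refine mul_le_mul_of_nonneg_left (Real.exp_le_exp.2 ?_) (abs_nonneg C)
  nlinarith [sq_nonneg (K - ‖x‖), sq_nonneg K]

lemma ET.integrable {f : E d → ℂ} (hf : ET f) : Integrable (fun x => f x * gw x) := by
  obtain ⟨cf, C, K, hC, hK, h⟩ := hf
  refine (bound_integrable C K).mono' (cf.mul gw_cont).aestronglyMeasurable
    (Filter.Eventually.of_forall fun x => ?_)
  rw [norm_mul, norm_gw]
  gcongr
  exact h x

lemma lin_smul (t : ℂ) (v : Fin d → ℂ) (x : E d) : lin (t • v) x = t * lin v x := by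
  simp only [lin, Pi.smul_apply, smul_eq_mul, Finset.mul_sum]
  exact Finset.sum_congr rfl fun i _ => by ring

lemma lin_add (v w : Fin d → ℂ) (x : E d) : lin (v + w) x = lin v x + lin w x := by
  simp only [lin, Pi.add_apply, mul_add, Finset.sum_add_distrib]

lemma hasDeriv {f : E d → ℂ} (hf : ET f) (v : Fin d → ℂ) (t₀ : ℂ) :
    HasDerivAt (fun t : ℂ => ∫ x, f x * Complex.exp (t * lin v x) * gw x)
      (∫ x, f x * lin v x * Complex.exp (t₀ * lin v x) * gw x) t₀ := by
  have he : ∀ t : ℂ, ET (fun x => Complex.exp (t * lin v x)) := fun t => by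
    simpa only [lin_smul] using ET.exp_lin (t • v)
  obtain ⟨cf, C, K, hC, hK, h⟩ := hf.mul (ET.lin v)
  set V := ∑ i, ‖v i‖ with hV
  refine (hasDerivAt_integral_of_dominated_loc_of_deriv_le
    (F' := fun t x => f x * lin v x * Complex.exp (t * lin v x) * gw x)
    (bound := fun x => C * Real.exp ((K + (‖t₀‖ + 1) * V) * ‖x‖) * Real.exp (-‖x‖ ^ 2))
    (Metric.ball_mem_nhds t₀ one_pos)
    (Filter.Eventually.of_forall fun t => (hf.mul (he t)).integrable.1)
    (hf.mul (he t₀)).integrable ((hf.mul (ET.lin v)).mul (he t₀)).integrable.1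
    (Filter.Eventually.of_forall fun x t ht => ?_) (bound_integrable _ _)
    (Filter.Eventually.of_forall fun x t ht => ?_)).2
  · rw [norm_mul, norm_gw, norm_mul, add_mul, Real.exp_add, ← mul_assoc]
    gcongr
    · exact h x
    · rw [Complex.norm_exp]
      refine Real.exp_le_exp.2 ((Complex.re_le_norm _).trans ?_)
      rw [norm_mul, mul_assoc]
      have : ‖t‖ ≤ ‖t₀‖ + 1 := by
        have h1 : ‖t - t₀‖ < 1 := by simpa [dist_eq_norm] using ht
        have h2 := norm_add_le (t - t₀) t₀
        rw [sub_add_cancel] at h2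
        linarith
      gcongr
      exact lin_bound v x
  · have := (((hasDerivAt_id t).mul_const (lin v x)).cexp.const_mul (f x)).mul_const (gw x)
    simp only [id] at this
    refine this.congr_deriv ?_
    ring

lemma base (w : Fin d → ℂ) : ∫ x, Complex.exp (lin w x) * gw x =
    ((Real.pi ^ ((d : ℝ) / 2) : ℝ) : ℂ) * Complex.exp ((∑ i, w i * w i) / 4) := by
  have h := GaussianFourier.integral_cexp_neg_mul_sum_add (b := 1) (by norm_num) w
  rw [← (PiLp.volume_preserving_toLp (Fin d)).integral_comp
    (MeasurableEquiv.toLp 2 _).measurableEmbedding]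
  have h2 : ((Real.pi : ℂ) / 1) ^ ((Fintype.card (Fin d) : ℂ) / 2) =
      ((Real.pi ^ ((d : ℝ) / 2) : ℝ) : ℂ) := by
    rw [Complex.ofReal_cpow Real.pi_pos.le]
    simp
  rw [h2] at h
  simp only [mul_one, pow_two] at h
  rw [← h]
  refine integral_congr_ae (Filter.Eventually.of_forall fun x => ?_)
  simp only [lin, gw]
  rw [← Complex.exp_add, add_comm, ← Complex.ofReal_pow, EuclideanSpace.norm_sq_eq]
  simp [pow_two, mul_comm]

lemma step1 (v : Fin d → ℂ) (hv : ∑ i, v i * v i = 0) (n : ℕ) : ∀ w : Fin d → ℂ,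
    ∫ x, lin v x ^ n * Complex.exp (lin w x) * gw x =
    ((Real.pi ^ ((d : ℝ) / 2) : ℝ) : ℂ) * ((∑ i, v i * w i) / 2) ^ n *
      Complex.exp ((∑ i, w i * w i) / 4) := by
  induction n with
  | zero => intro w; simpa using base w
  | succ n ih =>
    intro w
    have h := hasDeriv (((ET.lin v).pow n).mul (ET.exp_lin w)) v 0
    have e : ∀ t : ℂ, (∫ x, lin v x ^ n * Complex.exp (lin w x) * Complex.exp (t * lin v x) * gw x)
        = ((Real.pi ^ ((d : ℝ) / 2) : ℝ) : ℂ) * ((∑ i, v i * w i) / 2) ^ n *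
      Complex.exp ((∑ i, w i * w i) / 4 + t * ((∑ i, v i * w i) / 2)) := by
      intro t
      have := ih (w + t • v)
      have a1 : ∑ i, v i * (w + t • v) i = ∑ i, v i * w i := by
        have : ∑ i, v i * (w + t • v) i = ∑ i, v i * w i + t * ∑ i, v i * v i := by
          rw [Finset.mul_sum, ← Finset.sum_add_distrib]
          exact Finset.sum_congr rfl fun i _ => by simp; ring
        rw [this, hv]; ring
      have a2 : ∑ i, (w + t • v) i * (w + t • v) i
          = ∑ i, w i * w i + 2 * t * ∑ i, v i * w i := by
        have : ∑ i, (w + t • v) i * (w + t • v) i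
          = ∑ i, w i * w i + 2 * t * ∑ i, v i * w i + t ^ 2 * ∑ i, v i * v i := by
          rw [Finset.mul_sum, Finset.mul_sum, ← Finset.sum_add_distrib, ← Finset.sum_add_distrib]
          exact Finset.sum_congr rfl fun i _ => by simp; ring
        rw [this, hv]; ring
      rw [a1, a2] at this
      simp only [lin_add, lin_smul, Complex.exp_add] at this
      simp only [mul_assoc] at this ⊢
      rw [this]
      rw [show (∑ i, w i * w i + 2 * (t * ∑ i, v i * w i)) / 4 =
        (∑ i, w i * w i) / 4 + t * ((∑ i, v i * w i) / 2) by ring]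
    simp only [e] at h
    have h' := ((((hasDerivAt_id (0 : ℂ)).mul_const ((∑ i, v i * w i) / 2)).const_add
      ((∑ i, w i * w i) / 4)).cexp).const_mul
        (((Real.pi ^ ((d : ℝ) / 2) : ℝ) : ℂ) * ((∑ i, v i * w i) / 2) ^ n)
    have := h.unique h'
    simp only [id, zero_mul, add_zero, Complex.exp_zero, mul_one] at this
    rw [pow_succ]
    rw [show (∫ x, lin v x ^ (n + 1) * Complex.exp (lin w x) * gw x) =
      ∫ x, lin v x ^ n * Complex.exp (lin w x) * lin v x * gw x from
      integral_congr_ae (Filter.Eventually.of_forall fun x => by simp only; ring), this]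
    ring

lemma step2 (v w : Fin d → ℂ) (hv : ∑ i, v i * v i = 0) (hw : ∑ i, w i * w i = 0) (n m : ℕ) :
    ∀ t : ℂ, ∫ x, lin v x ^ n * lin w x ^ m * Complex.exp (t * lin w x) * gw x =
    ((Real.pi ^ ((d : ℝ) / 2) : ℝ) : ℂ) * ((∑ i, v i * w i) / 2) ^ n *
      ((n.descFactorial m : ℂ) * t ^ (n - m)) := by
  induction m with
  | zero =>
    intro t
    have := step1 v hv n (t • w)
    have a1 : ∑ i, v i * (t • w) i = t * ∑ i, v i * w i := by
      rw [Finset.mul_sum]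
      exact Finset.sum_congr rfl fun i _ => by simp; ring
    have a2 : ∑ i, (t • w) i * (t • w) i = 0 := by
      rw [← mul_zero (t ^ 2), ← hw, Finset.mul_sum]
      exact Finset.sum_congr rfl fun i _ => by simp; ring
    rw [a1, a2] at this
    simp only [lin_smul] at this
    simp only [pow_zero, mul_one, this]
    simp
    ring
  | succ m ih =>
    intro t
    have h := hasDeriv (((ET.lin v).pow n).mul ((ET.lin w).pow m)) w t
    simp only [ih] at h
    have h' := ((hasDerivAt_pow (n - m) t).const_mul (n.descFactorial m : ℂ)).const_mul
      (((Real.pi ^ ((d : ℝ) / 2) : ℝ) : ℂ) * ((∑ i, v i * w i) / 2) ^ n)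
    have := h.unique h'
    simp only [pow_succ, ← mul_assoc] at this ⊢
    rw [this, Nat.descFactorial_succ, Nat.sub_sub]
    push_cast
    ring

lemma gauss (v w : Fin d → ℂ) (hv : ∑ i, v i * v i = 0) (hw : ∑ i, w i * w i = 0) (n : ℕ) :
    ∫ x, lin v x ^ n * lin w x ^ n * gw x =
    ((Real.pi ^ ((d : ℝ) / 2) : ℝ) : ℂ) * ((∑ i, v i * w i) / 2) ^ n * (n.factorial : ℂ) := by
  have := step2 v w hv hw n n 0
  simpa [Nat.descFactorial_self] using this

lemma lin_real_smul (v : Fin d → ℂ) (r : ℝ) (x : E d) : lin v (r • x) = r * lin v x := by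
  simp only [lin, PiLp.smul_apply, smul_eq_mul, Finset.mul_sum, Complex.ofReal_mul, mul_assoc]

lemma radial (hd : 2 ≤ d) (l : ℕ) :
    ∫ r : Set.Ioi (0 : ℝ), ((r : ℝ) : ℂ) ^ (2 * l) * Complex.exp (-((r : ℝ) : ℂ) ^ 2)
      ∂(Measure.volumeIoiPow (d - 1)) = ((Real.Gamma (l + d / 2) / 2 : ℝ) : ℂ) := by
  simp only [Measure.volumeIoiPow, ENNReal.ofReal]
  rw [integral_withDensity_eq_integral_smul,
    integral_subtype_comap measurableSet_Ioi fun a : ℝ ↦ Real.toNNReal (a ^ (d - 1)) •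
      ((a : ℂ) ^ (2 * l) * Complex.exp (-(a : ℂ) ^ 2))]
  · have := _root_.integral_rpow_mul_exp_neg_rpow (p := 2) (q := 2 * l + (d - 1)) (by norm_num)
      (by have : (2 : ℝ) ≤ d := by exact_mod_cast hd
          have : (0 : ℝ) ≤ l := by positivity
          linarith)
    rw [show Real.Gamma (l + d / 2) / 2 = (1 / 2) * Real.Gamma ((2 * l + ((d : ℝ) - 1) + 1) / 2) by
      ring_nf, ← this, ← integral_complex_ofReal]
    refine setIntegral_congr_fun measurableSet_Ioi fun x hx ↦ ?_
    have hx0 : (0 : ℝ) < x := hx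
    have e : x ^ (2 * (l : ℝ) + ((d : ℝ) - 1)) = x ^ (d - 1) * x ^ (2 * l) := by
      rw [← pow_add, ← Real.rpow_natCast]
      congr 1
      push_cast [Nat.cast_sub (show 1 ≤ d by omega)]
      ring
    simp only [NNReal.smul_def]
    rw [Real.coe_toNNReal _ (pow_nonneg hx0.le _), e, Real.rpow_two, Complex.real_smul]
    push_cast
    ring
  · exact (measurable_subtype_coe.pow_const _).real_toNNReal

lemma polar (hd : 2 ≤ d) (v w : Fin d → ℂ) (l : ℕ) :
    ∫ x, lin v x ^ l * lin w x ^ l * gw x =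
    (∫ y, (lin v y.1 ^ l * lin w y.1 ^ l) ∂ sphMeasure d) *
      ((Real.Gamma (l + d / 2) / 2 : ℝ) : ℂ) := by
  have : Nonempty (Fin d) := ⟨⟨0, by omega⟩⟩
  rw [← radial hd, sphMeasure, ← integral_prod_mul]
  have hmp := (volume : Measure (E d)).measurePreserving_homeomorphUnitSphereProd
  rw [finrank_euclideanSpace_fin] at hmp
  rw [← hmp.integral_comp (Homeomorph.measurableEmbedding _)]
  have : ∫ x, lin v x ^ l * lin w x ^ l * gw x =
      ∫ x : ({(0)}ᶜ : Set (E d)), lin v x.1 ^ l * lin w x.1 ^ l * gw x.1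
        ∂((volume : Measure (E d)).comap (↑)) := by
    rw [integral_subtype_comap (measurableSet_singleton _).compl
      fun x ↦ lin v x ^ l * lin w x ^ l * gw x, restrict_compl_singleton]
  rw [this]
  refine integral_congr_ae (Filter.Eventually.of_forall fun x => ?_)
  have hx : ‖(x : E d)‖ ≠ 0 := norm_ne_zero_iff.2 x.2
  have hx' : (‖(x : E d)‖ : ℂ) ≠ 0 := by exact_mod_cast hx
  simp only [homeomorphUnitSphereProd_apply_fst_coe, homeomorphUnitSphereProd_apply_snd_coe,
    lin_real_smul, gw]
  push_cast
  rw [mul_pow, mul_pow, inv_pow, mul_comm 2 l, pow_mul]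
  field_simp

end SphIso

end

/-- for isotropic vectors `ζ₁, ζ₂ ∈ ℂ^d`,
`∫_{S^{d−1}} (y·ζ₁)^ℓ (y·ζ₂)^ℓ dσ(y) = (2 π^{d/2} ℓ!/Γ(ℓ+d/2)) ((ζ₁·ζ₂)/2)^ℓ`. -/
theorem sphere_integral_isotropic_powers (d : ℕ) (hd : 2 ≤ d) (ℓ : ℕ)
    (ζ₁ ζ₂ : Fin d → ℂ) (h1 : ∑ i, ζ₁ i * ζ₁ i = 0) (h2 : ∑ i, ζ₂ i * ζ₂ i = 0) :
    ∫ y, ((∑ i, ((y : EuclideanSpace ℝ (Fin d)) i : ℂ) * ζ₁ i) ^ ℓ *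
        (∑ i, ((y : EuclideanSpace ℝ (Fin d)) i : ℂ) * ζ₂ i) ^ ℓ) ∂ sphMeasure d =
      ((2 * Real.pi ^ ((d : ℝ) / 2) * (ℓ.factorial : ℝ) /
          Real.Gamma ((ℓ : ℝ) + (d : ℝ) / 2) : ℝ) : ℂ) * ((∑ i, ζ₁ i * ζ₂ i) / 2) ^ ℓ := by
  have hp := SphIso.polar hd ζ₁ ζ₂ ℓ
  rw [SphIso.gauss ζ₁ ζ₂ h1 h2 ℓ] at hp
  have hG : Real.Gamma ((ℓ : ℝ) + (d : ℝ) / 2) ≠ 0 := by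
    refine (Real.Gamma_pos_of_pos ?_).ne'
    have : (2 : ℝ) ≤ d := by exact_mod_cast hd
    positivity
  have hG' : (Real.Gamma ((ℓ : ℝ) + (d : ℝ) / 2) : ℂ) ≠ 0 := by exact_mod_cast hG
  simp only [SphIso.lin] at hp
  refine mul_right_cancel₀ (b := ((Real.Gamma (ℓ + d / 2) / 2 : ℝ) : ℂ)) ?_ (hp.symm.trans ?_)
  · push_cast
    exact div_ne_zero hG' two_ne_zero
  · rw [Complex.ofReal_div, Complex.ofReal_div]
    simp only [Complex.ofReal_mul, Complex.ofReal_natCast, Complex.ofReal_ofNat]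
    generalize (Real.Gamma ((ℓ : ℝ) + (d : ℝ) / 2) : ℂ) = G at hG'
    field_simp
end
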